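/- arXiv:2505.22384 — 2 statements merged into one kernel-verified Lean document; each statement's English description precedes it below -/
import Mathlib

section
/- The graph H has a multicolored clique (a set of k pairwise adjacent vertices containing exactly one vertex with each first coordinate) if and only if G admits a 𝒞-partition of value at least T, where T = k·(4𝒞³·(𝒞 − m − 1) + (3𝒞² + 2𝒞)·m + m·(m−1)) + (k(k−1)/2)·(2m + 1). -/
open scoped Classical

/-- The coalition-size bound `𝒞 = k(k−1)/2 + k·m + 1`. -/
def cap (k m : ℕ) : ℕ := k * (k - 1) / 2 + k * m + 1

/-- Vertices of the graph `G` built from `H`: the clique vertices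
`V^i = {u^i_ℓ, v^i_ℓ}` (encoded as `(i, ℓ, c)` with `c : Bool`), the vertices
`u_i`, the independent sets `I_i`, one vertex `v_e` for each edge `e` of `H`,
and the apex vertex `x`. -/
abbrev MCVtx (k m : ℕ) (H : SimpleGraph (Fin k × Fin (2 ^ m))) :=
  (Fin k × Fin m × Bool) ⊕ Fin k ⊕ (Fin k × Fin (cap k m - m - 1)) ⊕
    {e : Sym2 (Fin k × Fin (2 ^ m)) // e ∈ H.edgeSet} ⊕ Unit

/-- Base (directed) adjacency relation; the graph is its symmetrization.
The vertex `v_e` is joined to `(i, ℓ, c)` iff `e` has an endpoint `(i, a)`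
whose `ℓ`-th binary digit is `c` (this encodes `S_i(a)`). -/
def mcR (k m : ℕ) (H : SimpleGraph (Fin k × Fin (2 ^ m))) :
    MCVtx k m H → MCVtx k m H → Prop
  | Sum.inl a, Sum.inl b => a.1 = b.1 ∧ a ≠ b
  | Sum.inr (Sum.inl i), Sum.inl b => b.1 = i
  | Sum.inr (Sum.inl i), Sum.inr (Sum.inr (Sum.inl z)) => z.1 = i
  | Sum.inr (Sum.inr (Sum.inr (Sum.inl e))), Sum.inl b =>
      ∃ a : Fin (2 ^ m), (b.1, a) ∈ e.val ∧ a.val.testBit b.2.1.val = b.2.2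
  | Sum.inr (Sum.inr (Sum.inr (Sum.inr _))), Sum.inl _ => True
  | Sum.inr (Sum.inr (Sum.inr (Sum.inr _))), Sum.inr (Sum.inr (Sum.inr (Sum.inl _))) => True
  | _, _ => False

/-- The graph `G` of the construction. -/
def mcGraph (k m : ℕ) (H : SimpleGraph (Fin k × Fin (2 ^ m))) :
    SimpleGraph (MCVtx k m H) where
  Adj a b := mcR k m H a b ∨ mcR k m H b a
  symm := ⟨fun _ _ h => h.symm⟩
  loopless := by
    constructor
    intro a h
    rcases h with h | h <;>
      rcases a with a | i | z | e | u <;> simp [mcR] at h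

/-- Directed weights; the weight of an unordered pair is obtained by
symmetrizing. Weights: `4𝒞³` between `u_i` and `I_i`, `3𝒞²` between `u_i` and
`V^i`, `2𝒞` between `x` and `V^i`, and `1` everywhere else. -/
def mcD (k m : ℕ) (H : SimpleGraph (Fin k × Fin (2 ^ m))) :
    MCVtx k m H → MCVtx k m H → ℕ
  | Sum.inr (Sum.inl _), Sum.inr (Sum.inr (Sum.inl _)) => 4 * cap k m ^ 3
  | Sum.inr (Sum.inr (Sum.inl _)), Sum.inr (Sum.inl _) => 4 * cap k m ^ 3
  | Sum.inr (Sum.inl _), Sum.inl _ => 3 * cap k m ^ 2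
  | Sum.inl _, Sum.inr (Sum.inl _) => 3 * cap k m ^ 2
  | Sum.inr (Sum.inr (Sum.inr (Sum.inr _))), Sum.inl _ => 2 * cap k m
  | Sum.inl _, Sum.inr (Sum.inr (Sum.inr (Sum.inr _))) => 2 * cap k m
  | _, _ => 1

/-- The edge-weight function of `G`. -/
def mcW (k m : ℕ) (H : SimpleGraph (Fin k × Fin (2 ^ m))) :
    Sym2 (MCVtx k m H) → ℕ :=
  Sym2.lift ⟨fun a b => mcD k m H a b, by
    intro a b
    rcases a with a | i | z | e | u <;> rcases b with b | j | y | f | v <;> rfl⟩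

/-- The weight of the edges of `G` with both endpoints in `Q`. -/
noncomputable def partVal {V : Type*} [DecidableEq V] (G : SimpleGraph V)
    (w : Sym2 V → ℕ) (Q : Finset V) : ℕ :=
  ∑ e ∈ Q.sym2.filter (fun e => e ∈ G.edgeSet), w e

/-- The value of a partition `P` of the vertex set of `G`. -/
noncomputable def pVal {V : Type*} [Fintype V] [DecidableEq V] (G : SimpleGraph V)
    (w : Sym2 V → ℕ) (P : Finpartition (Finset.univ : Finset V)) : ℕ :=
  ∑ Q ∈ P.parts, partVal G w Q

open Finset

section General

variable {V : Type*} [DecidableEq V]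

theorem two_mul_partVal (G : SimpleGraph V) (w : Sym2 V → ℕ) (Q : Finset V) :
    2 * partVal G w Q = ∑ a ∈ Q, ∑ b ∈ Q, if G.Adj a b then w s(a, b) else 0 := by
  have hmaps : ∀ q ∈ (Q ×ˢ Q).filter (fun q => G.Adj q.1 q.2),
      s(q.1, q.2) ∈ Q.sym2.filter (fun e => e ∈ G.edgeSet) := by
    rintro ⟨a, b⟩ h
    simpa [Finset.mk_mem_sym2_iff] using h
  rw [← Finset.sum_product', ← Finset.sum_filter, ← Finset.sum_fiberwise_of_maps_to hmaps,
    partVal, Finset.mul_sum]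
  refine Finset.sum_congr rfl fun e he => ?_
  induction e using Sym2.ind with
  | _ a b =>
    simp only [Finset.mem_filter, Finset.mk_mem_sym2_iff, SimpleGraph.mem_edgeSet] at he
    obtain ⟨⟨ha, hb⟩, hab⟩ := he
    have hne : (a, b) ≠ (b, a) := fun h => hab.ne (congrArg Prod.fst h)
    have hfib : ((Q ×ˢ Q).filter (fun q => G.Adj q.1 q.2)).filter
        (fun q => s(q.1, q.2) = s(a, b)) = {(a, b), (b, a)} := by
      ext ⟨c, d⟩
      simp only [Finset.mem_filter, Finset.mem_product, Sym2.eq_iff, Finset.mem_insert,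
        Finset.mem_singleton, Prod.mk.injEq]
      constructor
      · exact fun h => h.2
      · rintro (⟨rfl, rfl⟩ | ⟨rfl, rfl⟩)
        · exact ⟨⟨⟨ha, hb⟩, hab⟩, Or.inl ⟨rfl, rfl⟩⟩
        · exact ⟨⟨⟨hb, ha⟩, hab.symm⟩, Or.inr ⟨rfl, rfl⟩⟩
    rw [hfib, Finset.sum_pair hne, Sym2.eq_swap (a := b) (b := a), two_mul]

theorem two_mul_pVal [Fintype V] (G : SimpleGraph V) (w : Sym2 V → ℕ)
    (P : Finpartition (Finset.univ : Finset V)) :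
    2 * pVal G w P =
      ∑ a, ∑ b, if G.Adj a b ∧ P.part a = P.part b then w s(a, b) else 0 := by
  have hsum := Finset.sum_biUnion (f := fun a => ∑ b, if G.Adj a b ∧ P.part a = P.part b then
    w s(a, b) else 0) P.supIndep.pairwiseDisjoint
  rw [← Finset.sup_eq_biUnion, P.sup_parts] at hsum
  rw [pVal, Finset.mul_sum, hsum]
  refine Finset.sum_congr rfl fun Q hQ => ?_
  rw [two_mul_partVal]
  refine Finset.sum_congr rfl fun a ha => ?_
  rw [← Finset.sum_filter, ← Finset.sum_filter]
  refine Finset.sum_congr ?_ fun _ _ => rfl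
  ext b
  have hb : P.part b = Q ↔ b ∈ Q := by
    rw [P.part_eq_iff_mem hQ]
  rw [Finset.mem_filter, Finset.mem_filter, P.part_eq_of_mem hQ ha, eq_comm (a := Q), hb]
  simp [and_comm]

theorem card_part_eq_le [Fintype V] {P : Finpartition (Finset.univ : Finset V)} {C : ℕ}
    (hP : ∀ Q ∈ P.parts, Q.card ≤ C) (t : Finset V) : #{v | P.part v = t} ≤ C := by
  rcases Finset.eq_empty_or_nonempty (Finset.univ.filter fun v => P.part v = t) with h | ⟨v, hv⟩
  · simp [h]
  · have ht : t ∈ P.parts := by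
      rw [← (Finset.mem_filter.1 hv).2]
      exact P.part_mem.2 (Finset.mem_univ v)
    refine (Finset.card_le_card fun a ha => ?_).trans (hP t ht)
    exact (P.part_eq_iff_mem ht).1 (Finset.mem_filter.1 ha).2

end General

section Construction

variable {k m : ℕ} {H : SimpleGraph (Fin k × Fin (2 ^ m))} {β : Type*} [DecidableEq β]

/-- The edges of `H`, as an index type for the vertices `v_e`. -/
abbrev HEdge (H : SimpleGraph (Fin k × Fin (2 ^ m))) : Type :=
  {e : Sym2 (Fin k × Fin (2 ^ m)) // e ∈ H.edgeSet}

/-- The vertex of some clique `V^i`. -/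
abbrev vV (H : SimpleGraph (Fin k × Fin (2 ^ m))) (v : Fin k × Fin m × Bool) : MCVtx k m H :=
  Sum.inl v

/-- The vertex `u_i`. -/
abbrev vU (H : SimpleGraph (Fin k × Fin (2 ^ m))) (i : Fin k) : MCVtx k m H :=
  Sum.inr (Sum.inl i)

/-- The vertex of some independent set `I_i`. -/
abbrev vI (H : SimpleGraph (Fin k × Fin (2 ^ m))) (z : Fin k × Fin (cap k m - m - 1)) :
    MCVtx k m H :=
  Sum.inr (Sum.inr (Sum.inl z))

/-- The vertex `v_e`. -/
abbrev vE (e : HEdge H) : MCVtx k m H :=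
  Sum.inr (Sum.inr (Sum.inr (Sum.inl e)))

/-- The vertex `x`. -/
abbrev vX (H : SimpleGraph (Fin k × Fin (2 ^ m))) : MCVtx k m H :=
  Sum.inr (Sum.inr (Sum.inr (Sum.inr ())))

/-- The adjacency between `v_e` and a vertex of some `V^i`. -/
def EAdj (e : HEdge H) (v : Fin k × Fin m × Bool) : Prop :=
  ∃ a : Fin (2 ^ m), (v.1, a) ∈ e.val ∧ a.val.testBit v.2.1.val = v.2.2

/-- The number of edges between some `u_i` and `I_i` inside the classes of `g`. -/
noncomputable def cntI (g : MCVtx k m H → β) : ℕ := #{z | g (vU H z.1) = g (vI H z)}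

/-- The number of edges between some `u_i` and `V^i` inside the classes of `g`. -/
noncomputable def cntV (g : MCVtx k m H → β) : ℕ := #{v | g (vU H v.1) = g (vV H v)}

/-- The number of edges between `x` and some `V^i` inside the class of `x`. -/
noncomputable def cntX (g : MCVtx k m H → β) : ℕ := #{v | g (vX H) = g (vV H v)}

/-- The number of edges between `x` and some `v_e` inside the class of `x`. -/
noncomputable def cntXE (g : MCVtx k m H → β) : ℕ := #{e : HEdge H | g (vX H) = g (vE e)}

/-- The number of edges between some `v_e` and some `V^i` inside the classes of `g`. -/
noncomputable def cntE (g : MCVtx k m H → β) : ℕ :=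
  #{q : HEdge H × (Fin k × Fin m × Bool) | EAdj q.1 q.2 ∧ g (vE q.1) = g (vV H q.2)}

/-- Twice the number of edges inside some `V^i` and inside the classes of `g`. -/
noncomputable def cntVV (g : MCVtx k m H → β) : ℕ :=
  #{q : (Fin k × Fin m × Bool) × (Fin k × Fin m × Bool) |
    (q.1.1 = q.2.1 ∧ q.1 ≠ q.2) ∧ g (vV H q.1) = g (vV H q.2)}

theorem sum_ite_fst_eq {ι γ : Type*} [Fintype ι] [DecidableEq ι] [Fintype γ] (p : ι → ι × γ → Prop)
    [∀ i, DecidablePred (p i)] (c : ℕ) :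
    (∑ i, ∑ z : ι × γ, if z.1 = i ∧ p i z then c else 0) = c * #{z : ι × γ | p z.1 z} := by
  rw [Finset.sum_comm, Finset.card_filter, Finset.mul_sum]
  refine Finset.sum_congr rfl fun z _ => ?_
  rw [Finset.sum_eq_single z.1]
  · simp
  · intro i _ hi
    simp [hi.symm]
  · simp

theorem two_mul_pVal_eq (P : Finpartition (Finset.univ : Finset (MCVtx k m H)))
    (g : MCVtx k m H → β) (hg : ∀ a b, P.part a = P.part b ↔ g a = g b) :
    2 * pVal (mcGraph k m H) (mcW k m H) P =
      2 * (4 * cap k m ^ 3 * cntI g + 3 * cap k m ^ 2 * cntV g + 2 * cap k m * cntX g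
        + cntE g + cntXE g) + cntVV g := by
  rw [two_mul_pVal]
  set F : MCVtx k m H → MCVtx k m H → ℕ := fun a b =>
    if (mcGraph k m H).Adj a b ∧ P.part a = P.part b then mcW k m H s(a, b) else 0 with hF
  change ∑ a, ∑ b, F a b = _
  have hsymm : ∀ a b, F a b = F b a := fun a b => by
    simp only [hF, (mcGraph k m H).adj_comm a b, eq_comm (a := P.part a), Sym2.eq_swap (a := a)]
  have hUI : ∑ i, ∑ z, F (vU H i) (vI H z) = 4 * cap k m ^ 3 * cntI g := by
    rw [cntI, ← sum_ite_fst_eq (fun i z => g (vU H i) = g (vI H z))]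
    exact Finset.sum_congr rfl fun i _ => Finset.sum_congr rfl fun z _ =>
      if_congr (and_congr (iff_of_eq (or_false _)) (hg _ _)) rfl rfl
  have hUV : ∑ i, ∑ z, F (vU H i) (vV H z) = 3 * cap k m ^ 2 * cntV g := by
    rw [cntV, ← sum_ite_fst_eq (fun i z => g (vU H i) = g (vV H z))]
    exact Finset.sum_congr rfl fun i _ => Finset.sum_congr rfl fun z _ =>
      if_congr (and_congr (iff_of_eq (or_false _)) (hg _ _)) rfl rfl
  have hXV : ∑ z, F (vX H) (vV H z) = 2 * cap k m * cntX g := by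
    rw [cntX, Finset.card_filter, Finset.mul_sum]
    refine Finset.sum_congr rfl fun z _ => ?_
    rw [mul_ite, mul_one, mul_zero]
    exact if_congr ((and_iff_right (Or.inl trivial)).trans (hg _ _)) rfl rfl
  have hXE : ∑ e : HEdge H, F (vX H) (vE e) = cntXE g := by
    rw [cntXE, Finset.card_filter]
    exact Finset.sum_congr rfl fun z _ =>
      if_congr ((and_iff_right (Or.inl trivial)).trans (hg _ _)) rfl rfl
  have hEV : ∑ e : HEdge H, ∑ v, F (vE e) (vV H v) = cntE g := by
    rw [cntE, Finset.card_filter, Fintype.sum_prod_type]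
    exact Finset.sum_congr rfl fun e _ => Finset.sum_congr rfl fun v _ =>
      if_congr (and_congr (iff_of_eq (or_false _)) (hg _ _)) rfl rfl
  have hVV : ∑ u, ∑ v, F (vV H u) (vV H v) = cntVV g := by
    rw [cntVV, Finset.card_filter, ← Fintype.sum_prod_type']
    refine Finset.sum_congr rfl fun q _ => if_congr (and_congr ?_ (hg _ _)) rfl rfl
    change (q.1.1 = q.2.1 ∧ q.1 ≠ q.2) ∨ (q.2.1 = q.1.1 ∧ q.2 ≠ q.1) ↔ _
    rw [eq_comm (a := q.2.1), ne_comm (a := q.2), or_self]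
  have hUU : ∀ i j, F (vU H i) (vU H j) = 0 :=
    fun _ _ => if_neg fun h => h.1.elim id id
  have hUE : ∀ i (e : HEdge H), F (vU H i) (vE e) = 0 :=
    fun _ _ => if_neg fun h => h.1.elim id id
  have hUX : ∀ i, F (vU H i) (vX H) = 0 :=
    fun _ => if_neg fun h => h.1.elim id id
  have hVI : ∀ v z, F (vV H v) (vI H z) = 0 :=
    fun _ _ => if_neg fun h => h.1.elim id id
  have hII : ∀ v z, F (vI H v) (vI H z) = 0 :=
    fun _ _ => if_neg fun h => h.1.elim id id
  have hIE : ∀ v (e : HEdge H), F (vI H v) (vE e) = 0 :=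
    fun _ _ => if_neg fun h => h.1.elim id id
  have hIX : ∀ v, F (vI H v) (vX H) = 0 :=
    fun _ => if_neg fun h => h.1.elim id id
  have hEE : ∀ e f : HEdge H, F (vE e) (vE f) = 0 :=
    fun _ _ => if_neg fun h => h.1.elim id id
  have hXX : F (vX H) (vX H) = 0 :=
    if_neg fun h => h.1.elim id id
  clear_value F
  clear hF
  have hVU := Finset.sum_comm (s := univ) (t := univ) (f := fun i z => F (vV H i) (vU H z))
  have hIU := Finset.sum_comm (s := univ) (t := univ) (f := fun i z => F (vI H i) (vU H z))
  have hVE := Finset.sum_comm (s := univ) (t := univ)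
    (f := fun i (z : HEdge H) => F (vV H i) (vE z))
  simp only [hsymm (vV H _) (vU H _), hsymm (vI H _) (vU H _), hsymm (vV H _) (vE _)]
    at hVU hIU hVE
  simp only [Fintype.sum_sum_type, Finset.sum_add_distrib, Finset.univ_unique,
    Finset.sum_singleton, PUnit.default_eq_unit, hUU, hUE, hUX, hVI, hII, hIE, hIX, hEE, hXX,
    hsymm (vV H _) (vU H _), hsymm (vI H _) (vU H _), hsymm (vV H _) (vE _),
    hsymm (vI H _) (vV H _), hsymm (vE _) (vU H _), hsymm (vX H) (vU H _),
    hsymm (vE _) (vI H _), hsymm (vX H) (vI H _), hsymm (vV H _) (vX H), hsymm (vE _) (vX H),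
    Finset.sum_const_zero, hVU, hIU, hVE, hUI, hUV, hXV, hXE, hEV, hVV]
  ring

theorem card_class_eq (g : MCVtx k m H → β) (t : β) :
    #{a | g a = t} = #{v | g (vV H v) = t} + #{i | g (vU H i) = t} + #{z | g (vI H z) = t}
      + #{e : HEdge H | g (vE e) = t} + if g (vX H) = t then 1 else 0 := by
  simp only [Finset.card_filter, Fintype.sum_sum_type, Finset.univ_unique,
    Finset.sum_singleton, PUnit.default_eq_unit]
  ring

theorem card_not_isDiag (k : ℕ) :
    #{z : Sym2 (Fin k) | ¬ z.IsDiag} = k * (k - 1) / 2 := by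
  rw [← Fintype.card_subtype, Sym2.card_subtype_not_diag, Fintype.card_fin, Nat.choose_two_right]

theorem card_selection (i : Fin k) (s : Fin m → Bool) :
    #{v : Fin k × Fin m × Bool | v.1 = i ∧ s v.2.1 = v.2.2} = m := by
  have h : ({v : Fin k × Fin m × Bool | v.1 = i ∧ s v.2.1 = v.2.2} : Finset _) =
      univ.image fun l => (i, l, s l) := by
    ext ⟨j, l, c⟩
    simp [eq_comm]
  rw [h, Finset.card_image_of_injective _ fun a b hab => (Prod.mk.inj (Prod.mk.inj hab).2).1,
    Finset.card_univ, Fintype.card_fin]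

theorem card_eq_sum_fst {γ : Type*} [Fintype γ] (p : Fin k × γ → Prop) [DecidablePred p] :
    #{v | p v} = ∑ i, #{v | v.1 = i ∧ p v} := by
  simp only [Finset.card_filter]
  rw [Finset.sum_comm]
  refine Finset.sum_congr rfl fun v _ => ?_
  rw [Finset.sum_eq_single v.1]
  · simp
  · intro i _ hi
    simp [hi.symm]
  · simp

theorem card_selections (s : Fin k → Fin m → Bool) :
    #{v : Fin k × Fin m × Bool | s v.1 v.2.1 = v.2.2} = k * m := by
  rw [card_eq_sum_fst]
  have h : ∀ i : Fin k, #{v : Fin k × Fin m × Bool | v.1 = i ∧ s v.1 v.2.1 = v.2.2} = m := by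
    intro i
    refine Eq.trans (congrArg _ ?_) (card_selection i (s i))
    ext v
    simp only [Finset.mem_filter, Finset.mem_univ, true_and]
    exact ⟨fun h => ⟨h.1, h.1 ▸ h.2⟩, fun h => ⟨h.1, h.1.symm ▸ h.2⟩⟩
  simp [h]

theorem HEdge.exists_eq (hH : ∀ a b, H.Adj a b → a.1 ≠ b.1) (e : HEdge H) :
    ∃ i j a b, i ≠ j ∧ e.val = s((i, a), (j, b)) := by
  obtain ⟨e, he⟩ := e
  induction e using Sym2.ind with
  | _ p q => exact ⟨p.1, q.1, p.2, q.2, hH _ _ he, rfl⟩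

theorem card_eAdj (hH : ∀ a b, H.Adj a b → a.1 ≠ b.1) (e : HEdge H) :
    #{v | EAdj e v} = 2 * m := by
  obtain ⟨i, j, a, b, hij, he⟩ := e.exists_eq hH
  have h : ({v | EAdj e v} : Finset _) =
      ({v : Fin k × Fin m × Bool | v.1 = i ∧ a.val.testBit v.2.1.val = v.2.2} : Finset _) ∪
      ({v : Fin k × Fin m × Bool | v.1 = j ∧ b.val.testBit v.2.1.val = v.2.2} : Finset _) := by
    ext v
    simp only [EAdj, he, Finset.mem_filter, Finset.mem_univ, true_and, Finset.mem_union,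
      Sym2.mem_iff, Prod.mk.injEq]
    constructor
    · rintro ⟨c, ⟨h, rfl⟩ | ⟨h, rfl⟩, hc⟩
      · exact Or.inl ⟨h, hc⟩
      · exact Or.inr ⟨h, hc⟩
    · rintro (⟨h, hc⟩ | ⟨h, hc⟩)
      · exact ⟨a, Or.inl ⟨h, rfl⟩, hc⟩
      · exact ⟨b, Or.inr ⟨h, rfl⟩, hc⟩
  rw [h, Finset.card_union_of_disjoint, card_selection i (fun l => a.val.testBit l.val),
    card_selection j (fun l => b.val.testBit l.val), two_mul]
  refine Finset.disjoint_left.2 fun v hv hw => hij ?_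
  rw [← (Finset.mem_filter.1 hv).2.1, ← (Finset.mem_filter.1 hw).2.1]

theorem isDiag_map_fst (hH : ∀ a b, H.Adj a b → a.1 ≠ b.1) (e : HEdge H) :
    ¬ (e.val.map Prod.fst).IsDiag := by
  obtain ⟨i, j, a, b, hij, he⟩ := e.exists_eq hH
  simpa [he] using hij

/-- On edges of `H` using at most one vertex of each colour, an edge is determined by its
pair of colours. -/
theorem injOn_map_fst (hH : ∀ a b, H.Adj a b → a.1 ≠ b.1) {S : Finset (HEdge H)}
    (hS : ∀ e ∈ S, ∀ e' ∈ S, ∀ i a a', (i, a) ∈ e.val → (i, a') ∈ e'.val → a = a') :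
    Set.InjOn (fun e : HEdge H => e.val.map Prod.fst) S := by
  intro e he e' he' h
  obtain ⟨i, j, a, b, hij, h1⟩ := e.exists_eq hH
  obtain ⟨i', j', a', b', hij', h2⟩ := e'.exists_eq hH
  have key := hS e he e' he'
  apply Subtype.ext
  simp only [h1, h2, Sym2.map_mk, Sym2.eq_iff] at h
  rcases h with ⟨rfl, rfl⟩ | ⟨rfl, rfl⟩
  · rw [h1, h2, key i a a' (by simp [h1]) (by simp [h2]), key j b b' (by simp [h1]) (by simp [h2])]
  · rw [h1, h2, key i a b' (by simp [h1]) (by simp [h2]), key j b a' (by simp [h1]) (by simp [h2]),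
      Sym2.eq_swap]

theorem card_le_of_consistent (hH : ∀ a b, H.Adj a b → a.1 ≠ b.1) {S : Finset (HEdge H)}
    (hS : ∀ e ∈ S, ∀ e' ∈ S, ∀ i a a', (i, a) ∈ e.val → (i, a') ∈ e'.val → a = a') :
    #S ≤ k * (k - 1) / 2 := by
  rw [← card_not_isDiag k]
  exact Finset.card_le_card_of_injOn _ (fun e _ => by simpa using isDiag_map_fst hH e)
    (injOn_map_fst hH hS)

/-- The class of a vertex in the partition obtained from a multicoloured clique `f`. -/
noncomputable def cliqueClass (f : Fin k → Fin (2 ^ m)) : MCVtx k m H → Option (Fin k ⊕ HEdge H)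
  | Sum.inl v => if (f v.1).val.testBit v.2.1.val = v.2.2 then none else some (Sum.inl v.1)
  | Sum.inr (Sum.inl i) => some (Sum.inl i)
  | Sum.inr (Sum.inr (Sum.inl z)) => some (Sum.inl z.1)
  | Sum.inr (Sum.inr (Sum.inr (Sum.inl e))) =>
      if ∀ q ∈ e.val, f q.1 = q.2 then none else some (Sum.inr e)
  | Sum.inr (Sum.inr (Sum.inr (Sum.inr _))) => none

section Clique

variable (f : Fin k → Fin (2 ^ m))

theorem cliqueClass_vV_eq_none {v : Fin k × Fin m × Bool} :
    cliqueClass f (vV H v) = none ↔ (f v.1).val.testBit v.2.1.val = v.2.2 := by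
  simp [cliqueClass]

theorem cliqueClass_vV_eq_some {v : Fin k × Fin m × Bool} {i : Fin k} :
    cliqueClass f (vV H v) = some (Sum.inl i) ↔
      v.1 = i ∧ (!(f i).val.testBit v.2.1.val) = v.2.2 := by
  rw [Bool.not_eq_eq_eq_not, ← Bool.not_eq_not, Bool.not_not]
  simp only [cliqueClass]
  split_ifs with h
  · simp only [false_iff, not_and, not_not]
    rintro rfl
    simp [h]
  · constructor
    · intro h'
      obtain rfl : v.1 = i := by simpa using h'
      exact ⟨rfl, by simpa [Bool.not_eq_not] using h⟩
    · rintro ⟨rfl, -⟩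
      rfl

theorem cliqueClass_vE_eq_none {e : HEdge H} :
    cliqueClass f (vE e) = none ↔ ∀ q ∈ e.val, f q.1 = q.2 := by
  simp [cliqueClass]

theorem card_clique_edges (hH : ∀ a b, H.Adj a b → a.1 ≠ b.1)
    (hf : ∀ i j, i ≠ j → H.Adj (i, f i) (j, f j)) :
    #{e : HEdge H | ∀ q ∈ e.val, f q.1 = q.2} = k * (k - 1) / 2 := by
  refine le_antisymm (card_le_of_consistent hH ?_) ?_
  · intro e he e' he' i a a' ha ha'
    exact ((Finset.mem_filter.1 he).2 _ ha).symm.trans ((Finset.mem_filter.1 he').2 _ ha')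
  · rw [← card_not_isDiag k]
    refine Finset.card_le_card_of_surjOn (fun e => e.val.map Prod.fst) fun z hz => ?_
    induction z using Sym2.ind with
    | _ i j =>
      have hij : i ≠ j := by simpa using hz
      exact ⟨⟨s((i, f i), (j, f j)), hf i j hij⟩, by simp +contextual [or_imp], rfl⟩

theorem card_cliqueClass_le (hk : 2 ≤ k) (hH : ∀ a b, H.Adj a b → a.1 ≠ b.1)
    (hf : ∀ i j, i ≠ j → H.Adj (i, f i) (j, f j)) (t : Option (Fin k ⊕ HEdge H)) :
    #{a | cliqueClass f a = t} ≤ cap k m := by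
  have hcap : cap k m = k * (k - 1) / 2 + k * m + 1 := rfl
  have hkm : 2 * m ≤ k * m := Nat.mul_le_mul_right m hk
  have hk1 : 1 ≤ k * (k - 1) / 2 := by
    rw [← Nat.choose_two_right]
    exact Nat.choose_pos hk
  rw [card_class_eq]
  rcases t with _ | i | e
  · simp only [cliqueClass_vV_eq_none, cliqueClass_vE_eq_none, card_clique_edges f hH hf]
    rw [card_selections fun i l => (f i).val.testBit l.val]
    simp only [cliqueClass, reduceCtorEq, Finset.filter_false, Finset.card_empty, if_true]
    omega
  · have hV : #{v | cliqueClass f (vV H v) = some (Sum.inl i)} = m := by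
      simp only [cliqueClass_vV_eq_some]
      exact card_selection i fun l => !(f i).val.testBit l.val
    have hI : #{z | cliqueClass f (vI H z) = some (Sum.inl i)} = cap k m - m - 1 := by
      have h : ({z | cliqueClass f (vI H z) = some (Sum.inl i)} : Finset _) =
          univ.image fun y => (i, y) := by
        ext ⟨j, y⟩
        simp [cliqueClass, eq_comm]
      rw [h, Finset.card_image_of_injective _ fun a b hab => (Prod.mk.inj hab).2,
        Finset.card_univ, Fintype.card_fin]
    have hE : #{e : HEdge H | cliqueClass f (vE e) = some (Sum.inl i)} = 0 := by
      simp [cliqueClass]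
    have hU : #{j | cliqueClass f (vU H j) = some (Sum.inl i)} = 1 := by
      simp [cliqueClass, Finset.filter_eq']
    rw [hV, hI, hE, hU, if_neg (by simp [cliqueClass])]
    omega
  · have hE : #{e' : HEdge H | cliqueClass f (vE e') = some (Sum.inr e)} ≤ 1 := by
      refine Finset.card_le_one.2 fun a ha b hb => ?_
      simp only [cliqueClass] at ha hb
      aesop
    have hV : #{v | cliqueClass f (vV H v) = some (Sum.inr e)} = 0 := by
      simp [cliqueClass]
    rw [hV, if_neg (by simp [cliqueClass])]
    simp only [cliqueClass, reduceCtorEq, Option.some.injEq, Finset.filter_false,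
      Finset.card_empty] at hE ⊢
    omega

theorem cntI_cliqueClass :
    cntI (H := H) (cliqueClass f) = k * (cap k m - m - 1) := by
  simp [cntI, cliqueClass]

theorem cntX_cliqueClass : cntX (H := H) (cliqueClass f) = k * m := by
  have h : ∀ v, cliqueClass f (vX H) = cliqueClass f (vV H v) ↔
      (f v.1).val.testBit v.2.1.val = v.2.2 := fun v => by
    rw [← cliqueClass_vV_eq_none (H := H), eq_comm]
    rfl
  simp only [cntX, h]
  exact card_selections fun i l => (f i).val.testBit l.val

theorem cntV_cliqueClass : cntV (H := H) (cliqueClass f) = k * m := by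
  have h : ∀ v : Fin k × Fin m × Bool, cliqueClass f (vU H v.1) = cliqueClass f (vV H v) ↔
      (!(f v.1).val.testBit v.2.1.val) = v.2.2 := fun v => by
    rw [eq_comm]
    exact (cliqueClass_vV_eq_some f).trans (and_iff_right rfl)
  simp only [cntV, h]
  exact card_selections fun i l => !(f i).val.testBit l.val

theorem cntXE_cliqueClass (hH : ∀ a b, H.Adj a b → a.1 ≠ b.1)
    (hf : ∀ i j, i ≠ j → H.Adj (i, f i) (j, f j)) :
    cntXE (H := H) (cliqueClass f) = k * (k - 1) / 2 := by
  have h : ∀ e : HEdge H, cliqueClass f (vX H) = cliqueClass f (vE e) ↔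
      ∀ q ∈ e.val, f q.1 = q.2 := fun e => by
    rw [← cliqueClass_vE_eq_none, eq_comm]
    rfl
  simp only [cntXE, h]
  exact card_clique_edges f hH hf

theorem le_cntE_cliqueClass (hH : ∀ a b, H.Adj a b → a.1 ≠ b.1)
    (hf : ∀ i j, i ≠ j → H.Adj (i, f i) (j, f j)) :
    k * (k - 1) / 2 * (2 * m) ≤ cntE (H := H) (cliqueClass f) := by
  rw [← card_clique_edges f hH hf, ← smul_eq_mul, ← Finset.sum_const, cntE, Finset.card_filter,
    Fintype.sum_prod_type]
  refine (Finset.sum_le_sum fun e he => ?_).trans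
    (Finset.sum_le_sum_of_subset (Finset.subset_univ _))
  rw [← card_eAdj hH e, Finset.card_filter]
  refine Finset.sum_le_sum fun v _ => ?_
  split_ifs with h1 h2
  · exact le_rfl
  · refine absurd ⟨h1, ?_⟩ h2
    have he' := (Finset.mem_filter.1 he).2
    obtain ⟨a, ha, hc⟩ := h1
    rw [(cliqueClass_vE_eq_none f).2 he', eq_comm, cliqueClass_vV_eq_none]
    rw [← hc, he' _ ha]
  · exact Nat.zero_le _
  · exact le_rfl

theorem le_cntVV_cliqueClass :
    k * (2 * (m * (m - 1))) ≤ cntVV (H := H) (cliqueClass f) := by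
  have hcard : #((univ : Finset (Fin k)) ×ˢ (univ : Finset Bool) ×ˢ
      (univ : Finset (Fin m)).offDiag) = k * (2 * (m * (m - 1))) := by
    simp [Finset.offDiag_card, Nat.mul_sub_one]
  rw [← hcard, cntVV]
  refine Finset.card_le_card_of_injOn
    (fun q => ((q.1, q.2.2.1, xor ((f q.1).val.testBit q.2.2.1.val) q.2.1),
      (q.1, q.2.2.2, xor ((f q.1).val.testBit q.2.2.2.val) q.2.1))) ?_ ?_
  · rintro ⟨i, d, l, l'⟩ h
    have hl : l ≠ l' := by simpa using h
    refine Finset.mem_coe.2 (Finset.mem_filter.2 ⟨Finset.mem_univ _, ?_⟩)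
    cases d <;> simp [cliqueClass, hl]
  · rintro ⟨i, d, l, l'⟩ - ⟨i', d', n, n'⟩ - h
    simp only [Prod.mk.injEq] at h
    obtain ⟨⟨rfl, rfl, h⟩, -, rfl, -⟩ := h
    simpa using h

end Clique

theorem exists_finpartition_of_map {V : Type*} [Fintype V] [DecidableEq V] (g : V → β) :
    ∃ P : Finpartition (Finset.univ : Finset V), (∀ a b, P.part a = P.part b ↔ g a = g b) ∧
      ∀ C, (∀ t, #{v | g v = t} ≤ C) → ∀ Q ∈ P.parts, Q.card ≤ C := by
  refine ⟨Finpartition.ofSetoid (Setoid.ker g), ?_, ?_⟩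
  · intro a b
    rw [← Finpartition.mem_part_iff_part_eq_part _ (Finset.mem_univ a) (Finset.mem_univ b),
      Finpartition.mem_part_ofSetoid_iff_rel, eq_comm]
    rfl
  · intro C hC Q hQ
    obtain ⟨a, -, rfl⟩ := Finset.mem_image.1 hQ
    refine (Finset.card_le_card fun b hb => ?_).trans (hC (g a))
    have hb' : g a = g b := (Finset.mem_filter.1 hb).2
    simp [hb']

theorem exists_finpartition_of_clique (hk : 2 ≤ k) (hH : ∀ a b, H.Adj a b → a.1 ≠ b.1)
    (f : Fin k → Fin (2 ^ m)) (hf : ∀ i j, i ≠ j → H.Adj (i, f i) (j, f j)) :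
    ∃ P : Finpartition (Finset.univ : Finset (MCVtx k m H)),
      (∀ Q ∈ P.parts, Q.card ≤ cap k m) ∧
      k * (4 * cap k m ^ 3 * (cap k m - m - 1) +
            (3 * cap k m ^ 2 + 2 * cap k m) * m + m * (m - 1)) +
          (k * (k - 1) / 2) * (2 * m + 1) ≤
        pVal (mcGraph k m H) (mcW k m H) P := by
  obtain ⟨P, hP, hcard⟩ := exists_finpartition_of_map (cliqueClass (H := H) f)
  refine ⟨P, hcard _ (card_cliqueClass_le f hk hH hf), ?_⟩
  have hval := two_mul_pVal_eq P _ hP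
  rw [cntI_cliqueClass, cntV_cliqueClass, cntX_cliqueClass, cntXE_cliqueClass f hH hf] at hval
  have hE := le_cntE_cliqueClass f hH hf
  have hVV := le_cntVV_cliqueClass (H := H) f
  nlinarith

section Backward

theorem le_of_weight_cube_le {k m C N K A V X E Y VV : ℕ} (hcap : C = K + k * m + 1) (hK : 1 ≤ K)
    (hkm : 2 ≤ k * m) (hN : N + m + 1 = C) (h1 : A + V + k ≤ k * C) (h2 : X + Y + 1 ≤ C)
    (h3 : VV + E + 2 * (k * m) ≤ 2 * (k * m) * C)
    (hT : 2 * (k * (4 * C ^ 3 * N + (3 * C ^ 2 + 2 * C) * m + m * (m - 1)) + K * (2 * m + 1)) ≤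
      2 * (4 * C ^ 3 * A + 3 * C ^ 2 * V + 2 * C * X + E + Y) + VV) :
    k * N ≤ A := by
  by_contra! hlt
  obtain ⟨d, hd⟩ := Nat.exists_eq_add_of_lt hlt
  have hB : V ≤ k * m + (d + 1) := by
    have : k * C = k * N + k * m + k := by rw [← hN]; ring
    omega
  have hA : 2 * (4 * C ^ 3 * (k * N)) + 2 * (3 * C ^ 2 * (k * m)) ≤
      2 * (4 * C ^ 3 * A) + 2 * (3 * C ^ 2 * V) + 2 * (2 * C * X) + 2 * E + 2 * Y + VV := by
    calc _ ≤ 2 * (k * (4 * C ^ 3 * N + (3 * C ^ 2 + 2 * C) * m + m * (m - 1))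
          + K * (2 * m + 1)) := by
          have : 0 ≤ 4 * (k * (C * m)) + 2 * (k * (m * (m - 1))) + 2 * (K * (2 * m + 1)) :=
            Nat.zero_le _
          linarith
      _ ≤ _ := hT
      _ = _ := by ring
  have hC4 : 4 ≤ C := by omega
  have hV : 2 * (3 * C ^ 2 * V) ≤ 2 * (3 * C ^ 2 * (k * m + (d + 1))) := by gcongr
  have hX : 2 * (2 * C * X) + 2 * Y ≤ 4 * C ^ 2 := by nlinarith
  have hkC : k * m * C ≤ C ^ 2 := by
    rw [pow_two]
    exact Nat.mul_le_mul_right C (by omega)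
  have hE : 2 * E + VV ≤ 4 * C ^ 2 := by linarith
  rw [hd] at hA
  have e3 : 4 * C ^ 2 * (d + 1) ≤ C ^ 3 * (d + 1) := by
    rw [pow_succ C 2, mul_comm (C ^ 2) C]
    gcongr
  have e4 : 0 < C ^ 2 := by positivity
  have e5 : 0 ≤ C ^ 2 * d := Nat.zero_le _
  linarith

theorem le_of_weight_sq_le {k m C K V X E Y VV : ℕ} (hcap : C = K + k * m + 1) (hK : 1 ≤ K)
    (hkm : 2 ≤ k * m) (h1 : X + V ≤ 2 * (k * m)) (h2 : X + Y + 1 ≤ C)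
    (h3 : VV + E + 2 * (k * m) ≤ 2 * (k * m) * C)
    (hT : 2 * (k * ((3 * C ^ 2 + 2 * C) * m + m * (m - 1)) + K * (2 * m + 1)) ≤
      2 * (3 * C ^ 2 * V + 2 * C * X + E + Y) + VV) :
    k * m ≤ V := by
  by_contra! hlt
  obtain ⟨s, hs⟩ := Nat.exists_eq_add_of_lt hlt
  have hX : X ≤ k * m + (s + 1) := by omega
  have hA : 2 * (3 * C ^ 2 * (k * m)) + 2 * (2 * C * (k * m)) ≤
      2 * (3 * C ^ 2 * V) + 2 * (2 * C * X) + 2 * E + 2 * Y + VV := by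
    calc _ ≤ 2 * (k * ((3 * C ^ 2 + 2 * C) * m + m * (m - 1)) + K * (2 * m + 1)) := by
          have : 0 ≤ 2 * (k * (m * (m - 1))) + 2 * (K * (2 * m + 1)) := Nat.zero_le _
          linarith
      _ ≤ _ := hT
      _ = _ := by ring
  have hC4 : 4 ≤ C := by omega
  have hX' : 2 * (2 * C * X) ≤ 2 * (2 * C * (k * m + (s + 1))) := by gcongr
  have hkC : k * m * C + C ≤ C ^ 2 := by
    rw [pow_two, ← Nat.succ_mul]
    exact Nat.mul_le_mul_right C (by omega)
  have hE : 2 * E + VV ≤ 4 * (k * m * C) := by linarith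
  have hkm' : 2 * (3 * C ^ 2 * (k * m)) = 2 * (3 * C ^ 2 * V) + 2 * (3 * C ^ 2 * (s + 1)) := by
    rw [hs]
    ring
  have e3 : 4 * C * (s + 1) ≤ C ^ 2 * (s + 1) := by
    rw [pow_two]
    gcongr
  have e4 : 0 ≤ C ^ 2 * s := Nat.zero_le _
  have e5 : 0 < C ^ 2 := by positivity
  linarith

variable {g : MCVtx k m H → β}

theorem card_fst_eq {γ : Type*} [Fintype γ] (i : Fin k) :
    #{v : Fin k × γ | v.1 = i} = Fintype.card γ := by
  have h : ({v : Fin k × γ | v.1 = i} : Finset _) = univ.image fun y => (i, y) := by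
    ext ⟨j, y⟩
    simp [eq_comm]
  rw [h, Finset.card_image_of_injective _ fun a b hab => (Prod.mk.inj hab).2, Finset.card_univ]

theorem cap_sub_add (hk : 2 ≤ k) : cap k m - m - 1 + m + 1 = cap k m := by
  have hcap : cap k m = k * (k - 1) / 2 + k * m + 1 := rfl
  have hkm : 2 * m ≤ k * m := Nat.mul_le_mul_right m hk
  omega

theorem cntI_le : cntI g ≤ k * (cap k m - m - 1) := by
  refine (Finset.card_filter_le _ _).trans ?_
  simp

theorem cntI_add_cntV_le (hC : ∀ t, #{a | g a = t} ≤ cap k m) :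
    cntI g + cntV g + k ≤ k * cap k m := by
  have h : ∀ i, #{z | z.1 = i ∧ g (vU H z.1) = g (vI H z)} +
      #{v | v.1 = i ∧ g (vU H v.1) = g (vV H v)} + 1 ≤ cap k m := by
    intro i
    have h0 := hC (g (vU H i))
    rw [card_class_eq] at h0
    have h1 : #{z | z.1 = i ∧ g (vU H z.1) = g (vI H z)} ≤ #{z | g (vI H z) = g (vU H i)} :=
      Finset.card_le_card fun z hz => by
        obtain ⟨rfl, hz'⟩ := (Finset.mem_filter.1 hz).2
        simp [hz']
    have h2 : #{v | v.1 = i ∧ g (vU H v.1) = g (vV H v)} ≤ #{v | g (vV H v) = g (vU H i)} :=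
      Finset.card_le_card fun z hz => by
        obtain ⟨rfl, hz'⟩ := (Finset.mem_filter.1 hz).2
        simp [hz']
    have h3 : 0 < #{j | g (vU H j) = g (vU H i)} :=
      Finset.card_pos.2 ⟨i, by simp⟩
    omega
  have hs := Finset.sum_le_sum fun (i : Fin k) (_ : i ∈ univ) => h i
  rw [Finset.sum_add_distrib, Finset.sum_add_distrib, ← card_eq_sum_fst, ← card_eq_sum_fst] at hs
  simpa [cntI, cntV] using hs

theorem cntX_add_cntXE_le (hC : ∀ t, #{a | g a = t} ≤ cap k m) :
    cntX g + cntXE g + 1 ≤ cap k m := by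
  have h0 := hC (g (vX H))
  rw [card_class_eq] at h0
  simp only [if_true] at h0
  simp only [cntX, cntXE, eq_comm (a := g (vX H))]
  omega

theorem cntE_eq_sum :
    cntE g = ∑ v, #{e : HEdge H | EAdj e v ∧ g (vE e) = g (vV H v)} := by
  simp only [cntE, Finset.card_filter]
  rw [Fintype.sum_prod_type_right]

theorem cntVV_add_cntE_le (hC : ∀ t, #{a | g a = t} ≤ cap k m) :
    cntVV g + cntE g + 2 * (k * m) ≤ 2 * (k * m) * cap k m := by
  have h : ∀ v, #{v' | (v.1 = v'.1 ∧ v ≠ v') ∧ g (vV H v) = g (vV H v')} +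
      #{e : HEdge H | EAdj e v ∧ g (vE e) = g (vV H v)} + 1 ≤ cap k m := by
    intro v
    have h0 := hC (g (vV H v))
    rw [card_class_eq] at h0
    have h1 : #{v' | (v.1 = v'.1 ∧ v ≠ v') ∧ g (vV H v) = g (vV H v')} <
        #{v' | g (vV H v') = g (vV H v)} := by
      refine Finset.card_lt_card (Finset.ssubset_iff_subset_ne.2 ⟨fun w hw => ?_, fun h => ?_⟩)
      · simpa using (Finset.mem_filter.1 hw).2.2.symm
      · have : v ∈ ({v' | (v.1 = v'.1 ∧ v ≠ v') ∧ g (vV H v) = g (vV H v')} : Finset _) := by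
          rw [h]
          simp
        exact (Finset.mem_filter.1 this).2.1.2 rfl
    have h2 : #{e : HEdge H | EAdj e v ∧ g (vE e) = g (vV H v)} ≤
        #{e : HEdge H | g (vE e) = g (vV H v)} :=
      Finset.card_le_card fun e he => by
        simpa using (Finset.mem_filter.1 he).2.2
    omega
  have hs := Finset.sum_le_sum fun (v : Fin k × Fin m × Bool) (_ : v ∈ univ) => h v
  rw [Finset.sum_add_distrib, Finset.sum_add_distrib, ← cntE_eq_sum] at hs
  have hVV : cntVV g = ∑ v, #{v' | (v.1 = v'.1 ∧ v ≠ v') ∧ g (vV H v) = g (vV H v')} := by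
    simp only [cntVV, Finset.card_filter]
    rw [← Fintype.sum_prod_type']
  rw [← hVV] at hs
  simp only [Finset.sum_const, Finset.card_univ, Fintype.card_prod, Fintype.card_fin,
    Fintype.card_bool, smul_eq_mul, mul_one] at hs
  calc _ = cntVV g + cntE g + k * (m * 2) := by ring
    _ ≤ k * (m * 2) * cap k m := hs
    _ = _ := by ring

theorem eq_of_cntI_eq (hI : cntI g = k * (cap k m - m - 1)) (z) : g (vU H z.1) = g (vI H z) := by
  have h : ({z | g (vU H z.1) = g (vI H z)} : Finset _) = univ :=
    Finset.eq_univ_of_card _ (by simpa [cntI] using hI)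
  have hz : z ∈ ({z | g (vU H z.1) = g (vI H z)} : Finset _) := by
    rw [h]
    exact Finset.mem_univ z
  exact (Finset.mem_filter.1 hz).2

/-- If all of `I_i` is together with `u_i`, only `m` further vertices fit into that class. -/
theorem card_class_vU_le (hk : 2 ≤ k) (hC : ∀ t, #{a | g a = t} ≤ cap k m)
    (hI : ∀ z, g (vU H z.1) = g (vI H z)) (i : Fin k) :
    #{v | g (vV H v) = g (vU H i)} + #{e : HEdge H | g (vE e) = g (vU H i)}
      + (if g (vX H) = g (vU H i) then 1 else 0) ≤ m := by
  have h0 := hC (g (vU H i))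
  rw [card_class_eq] at h0
  have h1 : cap k m - m - 1 ≤ #{z | g (vI H z) = g (vU H i)} := by
    have hN : #{z : Fin k × Fin (cap k m - m - 1) | z.1 = i} = cap k m - m - 1 :=
      (card_fst_eq i).trans (Fintype.card_fin _)
    refine hN.ge.trans (Finset.card_le_card fun z hz => ?_)
    obtain rfl := (Finset.mem_filter.1 hz).2
    simp [hI]
  have h3 : 0 < #{j | g (vU H j) = g (vU H i)} :=
    Finset.card_pos.2 ⟨i, by simp⟩
  have := cap_sub_add (m := m) hk
  omega

theorem card_own_le (i : Fin k) :
    #{v | v.1 = i ∧ g (vU H v.1) = g (vV H v)} ≤ #{v | g (vV H v) = g (vU H i)} :=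
  Finset.card_le_card fun z hz => by
    obtain ⟨rfl, hz'⟩ := (Finset.mem_filter.1 hz).2
    simp [hz']

theorem cntV_eq_sum : cntV g = ∑ i, #{v | v.1 = i ∧ g (vU H v.1) = g (vV H v)} :=
  card_eq_sum_fst _

theorem cntV_le (hk : 2 ≤ k) (hC : ∀ t, #{a | g a = t} ≤ cap k m)
    (hI : ∀ z, g (vU H z.1) = g (vI H z)) : cntV g ≤ k * m := by
  rw [cntV_eq_sum]
  refine (Finset.sum_le_card_nsmul _ _ m fun i _ => ?_).trans (by simp)
  have h1 := card_class_vU_le hk hC hI i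
  have h2 := card_own_le (g := g) i
  omega

theorem cntX_add_cntV_le (hk : 2 ≤ k) (hC : ∀ t, #{a | g a = t} ≤ cap k m)
    (hI : ∀ z, g (vU H z.1) = g (vI H z)) : cntX g + cntV g ≤ 2 * (k * m) := by
  by_cases hx : ∃ i, g (vX H) = g (vU H i)
  · obtain ⟨i, hi⟩ := hx
    have h1 := card_class_vU_le hk hC hI i
    have h2 := cntV_le hk hC hI
    have h3 : cntX g = #{v | g (vV H v) = g (vU H i)} := by
      simp only [cntX, hi, eq_comm]
    have hkm : 2 * m ≤ k * m := Nat.mul_le_mul_right m hk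
    omega
  · push Not at hx
    rw [cntX, cntV, ← Finset.card_union_of_disjoint]
    · refine (Finset.card_le_univ _).trans (le_of_eq ?_)
      simp only [Fintype.card_prod, Fintype.card_fin, Fintype.card_bool]
      ring
    · refine Finset.disjoint_left.2 fun v hv hw => hx v.1 ?_
      rw [(Finset.mem_filter.1 hv).2, (Finset.mem_filter.1 hw).2]

theorem cntI_eq_of_le (hk : 2 ≤ k) (hm : 1 ≤ m) (hC : ∀ t, #{a | g a = t} ≤ cap k m)
    (hT : 2 * (k * (4 * cap k m ^ 3 * (cap k m - m - 1) +
            (3 * cap k m ^ 2 + 2 * cap k m) * m + m * (m - 1)) +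
          (k * (k - 1) / 2) * (2 * m + 1)) ≤
      2 * (4 * cap k m ^ 3 * cntI g + 3 * cap k m ^ 2 * cntV g + 2 * cap k m * cntX g
        + cntE g + cntXE g) + cntVV g) :
    cntI g = k * (cap k m - m - 1) := by
  refine le_antisymm cntI_le ?_
  have hcap : cap k m = k * (k - 1) / 2 + k * m + 1 := rfl
  have hkm : 2 ≤ k * m := Nat.mul_le_mul hk hm
  have hk1 : 1 ≤ k * (k - 1) / 2 := by
    rw [← Nat.choose_two_right]
    exact Nat.choose_pos hk
  exact le_of_weight_cube_le hcap hk1 hkm (cap_sub_add hk) (cntI_add_cntV_le hC)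
    (cntX_add_cntXE_le hC) (cntVV_add_cntE_le hC) hT

theorem le_cntV_of_le (hk : 2 ≤ k) (hm : 1 ≤ m) (hC : ∀ t, #{a | g a = t} ≤ cap k m)
    (hI : ∀ z, g (vU H z.1) = g (vI H z))
    (hT : 2 * (k * ((3 * cap k m ^ 2 + 2 * cap k m) * m + m * (m - 1)) +
          (k * (k - 1) / 2) * (2 * m + 1)) ≤
      2 * (3 * cap k m ^ 2 * cntV g + 2 * cap k m * cntX g
        + cntE g + cntXE g) + cntVV g) :
    k * m ≤ cntV g := by
  have hcap : cap k m = k * (k - 1) / 2 + k * m + 1 := rfl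
  have hkm : 2 ≤ k * m := Nat.mul_le_mul hk hm
  have hk1 : 1 ≤ k * (k - 1) / 2 := by
    rw [← Nat.choose_two_right]
    exact Nat.choose_pos hk
  exact le_of_weight_sq_le hcap hk1 hkm (cntX_add_cntV_le hk hC hI)
    (cntX_add_cntXE_le hC) (cntVV_add_cntE_le hC) hT

end Backward

section Tight

variable {g : MCVtx k m H → β}

theorem eq_of_weight_le {k m C K X E Y VV : ℕ} (hcap : C = K + k * m + 1) (hCm : 2 * m < C)
    (hX : X ≤ k * m) (h2 : X + Y + 1 ≤ C) (hVV : VV ≤ k * (2 * (m * (m - 1))))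
    (hE : E ≤ 2 * m * Y + (k * m - X) * (C - 1))
    (hT : 2 * (k * ((3 * C ^ 2 + 2 * C) * m + m * (m - 1)) + K * (2 * m + 1)) ≤
      2 * (3 * C ^ 2 * (k * m) + 2 * C * X + E + Y) + VV) :
    X = k * m ∧ Y = K ∧ 2 * m * Y ≤ E := by
  obtain ⟨t, ht⟩ := Nat.exists_eq_add_of_le hX
  have hY : Y ≤ K + t := by omega
  have hA : 2 * (2 * C * (k * m)) + 2 * (K * (2 * m + 1)) ≤ 2 * (2 * C * X) + 2 * E + 2 * Y := by
    linarith
  rw [ht, Nat.add_sub_cancel_left] at hE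
  rw [ht] at hA
  obtain ⟨D, rfl⟩ : ∃ D, C = D + 1 := ⟨C - 1, by omega⟩
  rw [Nat.add_sub_cancel] at hE
  have hYm : 2 * m * Y ≤ 2 * m * (K + t) := by gcongr
  have hmt : 2 * m * t ≤ D * t := Nat.mul_le_mul_right t (by omega)
  have h0 : t = 0 := by nlinarith
  subst h0
  have hYK : Y = K := by
    refine le_antisymm hY ?_
    by_contra! hlt
    have : 2 * m * Y ≤ 2 * m * K := Nat.mul_le_mul_left _ hlt.le
    linarith
  subst hYK
  refine ⟨by omega, rfl, by linarith⟩

theorem card_own_eq (hk : 2 ≤ k) (hC : ∀ t, #{a | g a = t} ≤ cap k m)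
    (hI : ∀ z, g (vU H z.1) = g (vI H z)) (hV : cntV g = k * m)
    (i : Fin k) : #{v | v.1 = i ∧ g (vU H v.1) = g (vV H v)} = m := by
  have h : ∀ i ∈ (univ : Finset (Fin k)), #{v | v.1 = i ∧ g (vU H v.1) = g (vV H v)} ≤ m := by
    intro i _
    have h1 := card_class_vU_le hk hC hI i
    have h2 := card_own_le (g := g) i
    omega
  refine (Finset.sum_eq_sum_iff_of_le h).1 ?_ i (Finset.mem_univ i)
  rw [← cntV_eq_sum, hV]
  simp

theorem vX_ne_vU (hk : 2 ≤ k) (hC : ∀ t, #{a | g a = t} ≤ cap k m)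
    (hI : ∀ z, g (vU H z.1) = g (vI H z)) (hV : cntV g = k * m)
    (i : Fin k) : g (vX H) ≠ g (vU H i) := by
  intro h
  have h1 := card_class_vU_le hk hC hI i
  have h2 := card_own_le (g := g) i
  rw [card_own_eq hk hC hI hV] at h2
  rw [if_pos h] at h1
  omega

theorem vE_ne_vU (hk : 2 ≤ k) (hC : ∀ t, #{a | g a = t} ≤ cap k m)
    (hI : ∀ z, g (vU H z.1) = g (vI H z)) (hV : cntV g = k * m)
    (e : HEdge H) (i : Fin k) : g (vE e) ≠ g (vU H i) := by
  intro h
  have h1 := card_class_vU_le hk hC hI i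
  have h2 := card_own_le (g := g) i
  rw [card_own_eq hk hC hI hV] at h2
  have h3 : 0 < #{e : HEdge H | g (vE e) = g (vU H i)} :=
    Finset.card_pos.2 ⟨e, by simpa using h⟩
  omega

theorem card_not_own_eq (hk : 2 ≤ k) (hC : ∀ t, #{a | g a = t} ≤ cap k m)
    (hI : ∀ z, g (vU H z.1) = g (vI H z)) (hV : cntV g = k * m)
    (i : Fin k) : #{v | v.1 = i ∧ g (vU H v.1) ≠ g (vV H v)} = m := by
  have h := Finset.card_filter_add_card_filter_not
    (s := ({v | v.1 = i} : Finset (Fin k × Fin m × Bool))) (fun v => g (vU H v.1) = g (vV H v))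
  rw [Finset.filter_filter, Finset.filter_filter, card_own_eq hk hC hI hV, card_fst_eq] at h
  simp only [Fintype.card_prod, Fintype.card_fin, Fintype.card_bool] at h
  simp only [ne_eq]
  omega

theorem cntVV_le (hk : 2 ≤ k) (hC : ∀ t, #{a | g a = t} ≤ cap k m)
    (hI : ∀ z, g (vU H z.1) = g (vI H z)) (hV : cntV g = k * m) :
    cntVV g ≤ k * (2 * (m * (m - 1))) := by
  have hsub : ({q | (q.1.1 = q.2.1 ∧ q.1 ≠ q.2) ∧ g (vV H q.1) = g (vV H q.2)} : Finset _) ⊆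
      univ.biUnion fun i : Fin k =>
        ({v | v.1 = i ∧ g (vU H v.1) = g (vV H v)} : Finset _).offDiag ∪
        ({v | v.1 = i ∧ g (vU H v.1) ≠ g (vV H v)} : Finset _).offDiag := by
    rintro ⟨v, w⟩ hq
    obtain ⟨⟨h1, h2⟩, h3⟩ := (Finset.mem_filter.1 hq).2
    simp only at h1 h2 h3
    by_cases hv : g (vU H v.1) = g (vV H v)
    · have hw : g (vU H w.1) = g (vV H w) := by rw [← h1, hv, h3]
      exact Finset.mem_biUnion.2 ⟨v.1, Finset.mem_univ _, Finset.mem_union_left _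
        (Finset.mem_offDiag.2 ⟨by simpa using hv, by simpa [h1] using hw, h2⟩)⟩
    · have hw : g (vU H w.1) ≠ g (vV H w) := by rwa [← h1, ← h3]
      exact Finset.mem_biUnion.2 ⟨v.1, Finset.mem_univ _, Finset.mem_union_right _
        (Finset.mem_offDiag.2 ⟨by simpa using hv, by simpa [h1] using hw, h2⟩)⟩
  refine (Finset.card_le_card hsub).trans (Finset.card_biUnion_le.trans ?_)
  refine (Finset.sum_le_card_nsmul _ _ (2 * (m * (m - 1))) fun i _ => ?_).trans (by simp)
  refine (Finset.card_union_le _ _).trans (le_of_eq ?_)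
  rw [Finset.offDiag_card, Finset.offDiag_card, card_own_eq hk hC hI hV,
    card_not_own_eq hk hC hI hV, Nat.mul_sub_one, two_mul]

theorem cntX_le (hk : 2 ≤ k) (hC : ∀ t, #{a | g a = t} ≤ cap k m)
    (hI : ∀ z, g (vU H z.1) = g (vI H z)) (hV : cntV g = k * m) : cntX g ≤ k * m := by
  have := cntX_add_cntV_le hk hC hI
  omega

theorem card_free_le (hk : 2 ≤ k) (hC : ∀ t, #{a | g a = t} ≤ cap k m)
    (hI : ∀ z, g (vU H z.1) = g (vI H z)) (hV : cntV g = k * m) :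
    #{v | g (vX H) ≠ g (vV H v) ∧ g (vU H v.1) ≠ g (vV H v)} ≤ k * m - cntX g := by
  have h1 : #{v | g (vX H) ≠ g (vV H v) ∧ g (vU H v.1) ≠ g (vV H v)} + (cntX g + cntV g) ≤
      k * (m * 2) := by
    rw [cntX, cntV, ← Finset.card_union_of_disjoint, ← Finset.card_union_of_disjoint]
    · refine (Finset.card_le_univ _).trans (le_of_eq ?_)
      simp only [Fintype.card_prod, Fintype.card_fin, Fintype.card_bool]
    · refine Finset.disjoint_left.2 fun v hv hw => ?_
      obtain ⟨h1, h2⟩ := (Finset.mem_filter.1 hv).2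
      rcases Finset.mem_union.1 hw with h | h
      · exact h1 (Finset.mem_filter.1 h).2
      · exact h2 (Finset.mem_filter.1 h).2
    · refine Finset.disjoint_left.2 fun v hv hw => vX_ne_vU hk hC hI hV v.1 ?_
      rw [(Finset.mem_filter.1 hv).2, (Finset.mem_filter.1 hw).2]
  have h2 : k * (m * 2) = 2 * (k * m) := by ring
  omega

theorem card_eAdj_filter (hH : ∀ a b, H.Adj a b → a.1 ≠ b.1) :
    #{q : HEdge H × (Fin k × Fin m × Bool) | EAdj q.1 q.2 ∧ g (vX H) = g (vE q.1)} =
      2 * m * cntXE g := by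
  rw [cntXE, Finset.card_filter, Finset.card_filter, Fintype.sum_prod_type, Finset.mul_sum]
  refine Finset.sum_congr rfl fun e _ => ?_
  by_cases he : g (vX H) = g (vE e)
  · simp only [he, and_true, if_true, mul_one]
    rw [← Finset.card_filter, card_eAdj hH]
  · simp [he]

theorem cntE_le (hk : 2 ≤ k) (hC : ∀ t, #{a | g a = t} ≤ cap k m)
    (hI : ∀ z, g (vU H z.1) = g (vI H z)) (hV : cntV g = k * m)
    (hH : ∀ a b, H.Adj a b → a.1 ≠ b.1) :
    cntE g ≤ 2 * m * cntXE g + (k * m - cntX g) * (cap k m - 1) := by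
  have hsplit := Finset.card_filter_add_card_filter_not
    (s := ({q : HEdge H × (Fin k × Fin m × Bool) | EAdj q.1 q.2 ∧
      g (vE q.1) = g (vV H q.2)} : Finset _)) (fun q => g (vX H) = g (vV H q.2))
  rw [cntE, ← hsplit, ← card_eAdj_filter hH]
  refine Nat.add_le_add (Finset.card_le_card fun q hq => ?_) ?_
  · simp only [Finset.mem_filter, Finset.mem_univ, true_and] at hq ⊢
    exact ⟨hq.1.1, hq.2.trans hq.1.2.symm⟩
  · rw [mul_comm]
    refine (Finset.card_le_mul_card_image_of_maps_to (f := Prod.snd)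
      (t := ({v | g (vX H) ≠ g (vV H v) ∧ g (vU H v.1) ≠ g (vV H v)} : Finset _))
      (fun q hq => ?_) (cap k m - 1) fun v _ => ?_).trans
      (Nat.mul_le_mul_left _ (card_free_le hk hC hI hV))
    · simp only [Finset.mem_filter, Finset.mem_univ, true_and] at hq ⊢
      exact ⟨hq.2, fun h => vE_ne_vU hk hC hI hV q.1 q.2.1 (hq.1.2.trans h.symm)⟩
    · have h0 := hC (g (vV H v))
      rw [card_class_eq] at h0
      have h1 : 0 < #{w | g (vV H w) = g (vV H v)} := Finset.card_pos.2 ⟨v, by simp⟩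
      refine (Finset.card_le_card_of_injOn Prod.fst
        (t := ({e : HEdge H | g (vE e) = g (vV H v)} : Finset _)) (fun q hq => ?_)
        fun q hq q' hq' h => ?_).trans (by omega)
      · simp only [Finset.coe_filter, Finset.mem_filter, Finset.mem_univ, true_and,
          Set.mem_ofPred_eq] at hq ⊢
        rw [hq.1.1.2, hq.2]
      · exact Prod.ext h (((Finset.mem_filter.1 hq).2).trans ((Finset.mem_filter.1 hq').2).symm)

theorem vX_eq_vV_of_eAdj (hk : 2 ≤ k) (hC : ∀ t, #{a | g a = t} ≤ cap k m)
    (hI : ∀ z, g (vU H z.1) = g (vI H z)) (hV : cntV g = k * m)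
    (hH : ∀ a b, H.Adj a b → a.1 ≠ b.1) (hX : cntX g = k * m)
    (hE : 2 * m * cntXE g ≤ cntE g) {e : HEdge H} (he : g (vX H) = g (vE e))
    {v : Fin k × Fin m × Bool} (hv : EAdj e v) : g (vX H) = g (vV H v) := by
  have hfree : ∀ v, g (vX H) = g (vV H v) ∨ g (vU H v.1) = g (vV H v) := by
    intro v
    by_contra! h
    have h1 := card_free_le hk hC hI hV
    have h2 : 0 < #{v | g (vX H) ≠ g (vV H v) ∧ g (vU H v.1) ≠ g (vV H v)} :=
      Finset.card_pos.2 ⟨v, by simpa using h⟩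
    omega
  have hsub : ({q | EAdj q.1 q.2 ∧ g (vE q.1) = g (vV H q.2)} :
      Finset (HEdge H × (Fin k × Fin m × Bool))) ⊆
      ({q | EAdj q.1 q.2 ∧ g (vX H) = g (vE q.1)} :
      Finset (HEdge H × (Fin k × Fin m × Bool))) := fun q hq => by
    simp only [Finset.mem_filter, Finset.mem_univ, true_and] at hq ⊢
    refine ⟨hq.1, ((hfree q.2).resolve_right fun h => ?_).trans hq.2.symm⟩
    exact vE_ne_vU hk hC hI hV q.1 q.2.1 (hq.2.trans h.symm)
  have heq := Finset.eq_of_subset_of_card_le hsub ((card_eAdj_filter hH).trans_le hE)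
  have hmem : (e, v) ∈ ({q | EAdj q.1 q.2 ∧ g (vE q.1) = g (vV H q.2)} :
      Finset (HEdge H × (Fin k × Fin m × Bool))) := by
    rw [heq]
    simpa using ⟨hv, he⟩
  exact he.trans (Finset.mem_filter.1 hmem).2.2

/-- If all neighbours of `v_e` and `v_f` lie in the class of `x`, then `e` and `f` do not use
different vertices of the same colour. -/
theorem eq_of_mem_of_eAdj (hk : 2 ≤ k) (hC : ∀ t, #{a | g a = t} ≤ cap k m)
    (hI : ∀ z, g (vU H z.1) = g (vI H z)) (hV : cntV g = k * m)
    {e e' : HEdge H} (he : ∀ v, EAdj e v → g (vX H) = g (vV H v))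
    (he' : ∀ v, EAdj e' v → g (vX H) = g (vV H v)) {i : Fin k} {a a' : Fin (2 ^ m)}
    (ha : (i, a) ∈ e.val) (ha' : (i, a') ∈ e'.val) : a = a' := by
  have hle : #{v | v.1 = i ∧ g (vX H) = g (vV H v)} ≤ m := by
    refine (Finset.card_le_card fun v hv => ?_).trans (card_not_own_eq hk hC hI hV i).le
    simp only [Finset.mem_filter, Finset.mem_univ, true_and] at hv ⊢
    exact ⟨hv.1, fun h => vX_ne_vU hk hC hI hV v.1 (hv.2.trans h.symm)⟩
  have key : ∀ (e : HEdge H) (a : Fin (2 ^ m)), (∀ v, EAdj e v → g (vX H) = g (vV H v)) →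
      (i, a) ∈ e.val → ({v | v.1 = i ∧ a.val.testBit v.2.1.val = v.2.2} :
        Finset (Fin k × Fin m × Bool)) =
      ({v | v.1 = i ∧ g (vX H) = g (vV H v)} : Finset (Fin k × Fin m × Bool)) := by
    intro e a he ha
    refine Finset.eq_of_subset_of_card_le (fun v hv => ?_) ?_
    · simp only [Finset.mem_filter, Finset.mem_univ, true_and] at hv ⊢
      exact ⟨hv.1, he v ⟨a, by rwa [hv.1], hv.2⟩⟩
    · exact hle.trans (card_selection i fun l => a.val.testBit l.val).ge
  have h := (key e a he ha).trans (key e' a' he' ha').symm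
  refine Fin.ext (Nat.eq_of_testBit_eq fun l => ?_)
  by_cases hl : l < m
  · have hmem : (i, ⟨l, hl⟩, a.val.testBit l) ∈
        ({v | v.1 = i ∧ a.val.testBit v.2.1.val = v.2.2} : Finset (Fin k × Fin m × Bool)) := by
      simp
    rw [h] at hmem
    exact (Finset.mem_filter.1 hmem).2.2.symm
  · have hlt : ∀ b : Fin (2 ^ m), b.val.testBit l = false := fun b =>
      Nat.testBit_lt_two_pow (b.isLt.trans_le (Nat.pow_le_pow_right two_pos (not_lt.1 hl)))
    rw [hlt, hlt]

end Tight

/-- A consistent family of `k(k−1)/2` edges of `H` yields a multicolored clique. -/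
theorem exists_clique_of_consistent (hk : 2 ≤ k) (hH : ∀ a b, H.Adj a b → a.1 ≠ b.1)
    {S : Finset (HEdge H)}
    (hS : ∀ e ∈ S, ∀ e' ∈ S, ∀ i a a', (i, a) ∈ e.val → (i, a') ∈ e'.val → a = a')
    (hcard : k * (k - 1) / 2 ≤ #S) :
    ∃ f : Fin k → Fin (2 ^ m), ∀ i j : Fin k, i ≠ j → H.Adj (i, f i) (j, f j) := by
  have hsurj : ∀ i j : Fin k, i ≠ j → ∃ e ∈ S, e.val.map Prod.fst = s(i, j) := by
    intro i j hij
    have h := Finset.surjOn_of_injOn_of_card_le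
      (t := ({z | ¬ z.IsDiag} : Finset (Sym2 (Fin k)))) _
      (fun e _ => by simpa using isDiag_map_fst hH e) (injOn_map_fst hH hS)
      ((card_not_isDiag k).trans_le hcard)
    obtain ⟨e, he, h⟩ := h (a := s(i, j)) (by simpa using hij)
    exact ⟨e, he, h⟩
  have hpair : ∀ i j : Fin k, i ≠ j → ∃ e ∈ S, ∃ a b, e.val = s((i, a), (j, b)) := by
    intro i j hij
    obtain ⟨e, he, h⟩ := hsurj i j hij
    obtain ⟨i', j', a, b, -, h'⟩ := e.exists_eq hH
    rw [h', Sym2.map_mk, Sym2.eq_iff] at h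
    rcases h with ⟨rfl, rfl⟩ | ⟨rfl, rfl⟩
    · exact ⟨e, he, a, b, h'⟩
    · exact ⟨e, he, b, a, h'.trans Sym2.eq_swap⟩
  have hone : ∀ i : Fin k, ∃ a, ∃ e ∈ S, (i, a) ∈ e.val := by
    intro i
    have : Nontrivial (Fin k) := Fin.nontrivial_iff_two_le.2 hk
    obtain ⟨j, hj⟩ := exists_ne i
    obtain ⟨e, he, a, b, h⟩ := hpair i j hj.symm
    exact ⟨a, e, he, by simp [h]⟩
  choose f e' he' hf using hone
  refine ⟨f, fun i j hij => ?_⟩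
  obtain ⟨e, he, a, b, h⟩ := hpair i j hij
  have ha : a = f i := hS e he _ (he' i) i a _ (by simp [h]) (hf i)
  have hb : b = f j := hS e he _ (he' j) j b _ (by simp [h]) (hf j)
  have := e.property
  rw [h, SimpleGraph.mem_edgeSet] at this
  rwa [← ha, ← hb]

theorem exists_clique_of_finpartition (hk : 2 ≤ k) (hm : 1 ≤ m)
    (hH : ∀ a b, H.Adj a b → a.1 ≠ b.1)
    (P : Finpartition (Finset.univ : Finset (MCVtx k m H)))
    (hP : ∀ Q ∈ P.parts, Q.card ≤ cap k m)
    (hT : k * (4 * cap k m ^ 3 * (cap k m - m - 1) +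
            (3 * cap k m ^ 2 + 2 * cap k m) * m + m * (m - 1)) +
          (k * (k - 1) / 2) * (2 * m + 1) ≤
        pVal (mcGraph k m H) (mcW k m H) P) :
    ∃ f : Fin k → Fin (2 ^ m), ∀ i j : Fin k, i ≠ j → H.Adj (i, f i) (j, f j) := by
  have hC : ∀ t, #{a | P.part a = t} ≤ cap k m := card_part_eq_le hP
  have hT1 := (Nat.mul_le_mul_left 2 hT).trans_eq (two_mul_pVal_eq P P.part fun _ _ => Iff.rfl)
  have hIeq := cntI_eq_of_le hk hm hC hT1
  have hI := eq_of_cntI_eq hIeq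
  have hT2 : 2 * (k * ((3 * cap k m ^ 2 + 2 * cap k m) * m + m * (m - 1)) +
          (k * (k - 1) / 2) * (2 * m + 1)) ≤
      2 * (3 * cap k m ^ 2 * cntV P.part + 2 * cap k m * cntX P.part
        + cntE P.part + cntXE P.part) + cntVV P.part := by
    rw [hIeq] at hT1
    linarith
  have hV := (cntV_le hk hC hI).antisymm (le_cntV_of_le hk hm hC hI hT2)
  have hkm : 2 * m ≤ k * m := Nat.mul_le_mul_right m hk
  rw [hV] at hT2
  obtain ⟨hX, hXE, hE⟩ := eq_of_weight_le rfl
    (hkm.trans_lt (Nat.lt_succ_of_le (Nat.le_add_left _ _))) (cntX_le hk hC hI hV)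
    (cntX_add_cntXE_le hC) (cntVV_le hk hC hI hV) (cntE_le hk hC hI hV hH) hT2
  refine exists_clique_of_consistent hk hH
    (S := {e | P.part (vX H) = P.part (vE e)}) (fun e he e' he' i a a' ha ha' => ?_) hXE.ge
  exact eq_of_mem_of_eAdj hk hC hI hV
    (fun v => vX_eq_vV_of_eAdj hk hC hI hV hH hX hE (Finset.mem_filter.1 he).2)
    (fun v => vX_eq_vV_of_eAdj hk hC hI hV hH hX hE (Finset.mem_filter.1 he').2) ha ha'


end Construction
/-- `H` has a multicolored clique iff `G` admits a 𝒞-partition of value at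
least `T`. -/
theorem stmt15 (k m : ℕ) (hk : 2 ≤ k) (hm : 1 ≤ m)
    (H : SimpleGraph (Fin k × Fin (2 ^ m)))
    (hH : ∀ a b : Fin k × Fin (2 ^ m), H.Adj a b → a.1 ≠ b.1) :
    (∃ f : Fin k → Fin (2 ^ m), ∀ i j : Fin k, i ≠ j → H.Adj (i, f i) (j, f j)) ↔
    (∃ P : Finpartition (Finset.univ : Finset (MCVtx k m H)),
      (∀ Q ∈ P.parts, Q.card ≤ cap k m) ∧
      k * (4 * cap k m ^ 3 * (cap k m - m - 1) +
            (3 * cap k m ^ 2 + 2 * cap k m) * m + m * (m - 1)) +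
          (k * (k - 1) / 2) * (2 * m + 1) ≤
        pVal (mcGraph k m H) (mcW k m H) P) := by
  exact ⟨fun ⟨f, hf⟩ => exists_finpartition_of_clique hk hH f hf,
    fun ⟨P, hP, hT⟩ => exists_clique_of_finpartition hk hm hH P hP hT⟩
end

section
/- In every optimal 𝒞-partition P of the graph G, the part Q of P containing the vertex x satisfies |Q ∩ V^i| = m for every i ∈ Fin k. -/
open scoped Classical

/-- The edges of `G` whose endpoints get the same label under `f`. -/
noncomputable def monoEdges {V L : Type*} [Fintype V] [DecidableEq V] (G : SimpleGraph V)
    (f : V → L) : Finset (Sym2 V) :=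
  Finset.univ.filter (fun e => e ∈ G.edgeSet ∧ (e.map f).IsDiag)

lemma mem_monoEdges {V L : Type*} [Fintype V] [DecidableEq V] {G : SimpleGraph V}
    {f : V → L} {e : Sym2 V} : e ∈ monoEdges G f ↔ e ∈ G.edgeSet ∧ (e.map f).IsDiag := by
  simp [monoEdges]

lemma pVal_eq_sum_monoEdges {V : Type*} [Fintype V] [DecidableEq V] (G : SimpleGraph V)
    (w : Sym2 V → ℕ) (P : Finpartition (Finset.univ : Finset V)) :
    pVal G w P = ∑ e ∈ monoEdges G P.part, w e := by
  unfold pVal partVal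
  rw [← Finset.sum_biUnion]
  · refine Finset.sum_congr ?_ fun _ _ => rfl
    ext e
    induction e using Sym2.ind with
    | _ a b =>
      simp only [Finset.mem_biUnion, Finset.mem_filter, Finset.mk_mem_sym2_iff, mem_monoEdges,
        Sym2.map_mk, Sym2.mk_isDiag_iff]
      constructor
      · rintro ⟨Q, hQ, ⟨ha, hb⟩, he⟩
        exact ⟨he, (P.part_eq_of_mem hQ ha).trans (P.part_eq_of_mem hQ hb).symm⟩
      · rintro ⟨he, hab⟩
        exact ⟨P.part a, P.part_mem.2 (Finset.mem_univ a),
          ⟨P.mem_part (Finset.mem_univ a), hab ▸ P.mem_part (Finset.mem_univ b)⟩, he⟩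
  · intro Q hQ R hR hne
    rw [Function.onFun, Finset.disjoint_left]
    intro e heQ heR
    induction e using Sym2.ind with
    | _ a b =>
      simp only [Finset.mem_filter, Finset.mk_mem_sym2_iff] at heQ heR
      exact hne (P.eq_of_mem_parts hQ hR heQ.1.1 heR.1.1)

/-- A labelling with small fibres is realised by a partition with small parts. -/
lemma exists_finpartition_of_labelling {V L : Type*} [Fintype V] [DecidableEq V]
    (G : SimpleGraph V) (w : Sym2 V → ℕ) (f : V → L) (c : ℕ)
    (hf : ∀ y, (Finset.univ.filter (fun v => f v = y)).card ≤ c) :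
    ∃ P : Finpartition (Finset.univ : Finset V), (∀ Q ∈ P.parts, Q.card ≤ c) ∧
      pVal G w P = ∑ e ∈ monoEdges G f, w e := by
  have key : ∀ a b, (Finpartition.ofSetoid (Setoid.ker f)).part a =
      (Finpartition.ofSetoid (Setoid.ker f)).part b ↔ f a = f b := by
    intro a b
    rw [← Finpartition.mem_part_iff_part_eq_part _ (Finset.mem_univ _) (Finset.mem_univ _),
      Finpartition.mem_part_ofSetoid_iff_rel, Setoid.ker_def]
    exact eq_comm
  refine ⟨Finpartition.ofSetoid (Setoid.ker f), ?_, ?_⟩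
  · intro Q hQ
    obtain ⟨a, ha⟩ := Finpartition.nonempty_of_mem_parts _ hQ
    refine le_trans (Finset.card_le_card ?_) (hf (f a))
    intro b hb
    simp only [Finset.mem_filter, Finset.mem_univ, true_and]
    rw [← key, Finpartition.part_eq_of_mem _ hQ ha, Finpartition.part_eq_of_mem _ hQ hb]
  · rw [pVal_eq_sum_monoEdges]
    refine Finset.sum_congr ?_ fun _ _ => rfl
    ext e
    induction e using Sym2.ind with
    | _ a b => simp [mem_monoEdges, key]

/-- Few edges inside fibres can touch a given set of vertices. -/
lemma card_le_of_touching {V L : Type*} [Fintype V] [DecidableEq V] (G : SimpleGraph V)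
    (f : V → L) (c : ℕ) (hf : ∀ y, (Finset.univ.filter (fun v => f v = y)).card ≤ c)
    (S : Finset (Sym2 V)) (hS : S ⊆ monoEdges G f) (Y : Finset V)
    (hY : ∀ e ∈ S, ∃ y ∈ Y, y ∈ e) : S.card ≤ Y.card * (c - 1) := by
  have hsub : S ⊆ Y.biUnion (fun y =>
      ((Finset.univ.filter (fun v => f v = f y)).erase y).image (fun v => s(y, v))) := by
    intro e he
    obtain ⟨y, hy, hye⟩ := hY e he
    obtain ⟨v, rfl⟩ := Sym2.mem_iff_exists.1 hye
    have h := mem_monoEdges.1 (hS he)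
    have hadj : G.Adj y v := by simpa using h.1
    simp only [Finset.mem_biUnion, Finset.mem_image, Finset.mem_erase, Finset.mem_filter,
      Finset.mem_univ, true_and]
    refine ⟨y, hy, v, ⟨hadj.ne', ?_⟩, rfl⟩
    have := h.2
    simp only [Sym2.map_mk, Sym2.mk_isDiag_iff] at this
    exact this.symm
  refine (Finset.card_le_card hsub).trans (Finset.card_biUnion_le_card_mul _ _ _ ?_)
  intro y _
  refine Finset.card_image_le.trans ?_
  rw [Finset.card_erase_of_mem (by simp)]
  exact Nat.sub_le_sub_right (hf _) 1

lemma value_lt_of_few_hubLeaves {C N q a b d t : ℕ} (hC : q + 2 ≤ C) (ha : a < N)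
    (hb : b ≤ 2 * q) (hd : d ≤ 2 * q) (ht : t ≤ (2 * q + 1) * (C - 1)) :
    4 * C ^ 3 * a + 3 * C ^ 2 * b + 2 * C * d + t <
      4 * C ^ 3 * N + 3 * C ^ 2 * q + 2 * C * q := by
  obtain ⟨c, rfl⟩ : ∃ c, C = c + 2 := ⟨C - 2, by omega⟩
  have hq : q ≤ c := by omega
  replace ht : t ≤ (2 * q + 1) * (c + 1) := ht
  have e1 : 4 * (c + 2) ^ 3 * (a + 1) ≤ 4 * (c + 2) ^ 3 * N := Nat.mul_le_mul_left _ ha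
  have e2 : 3 * (c + 2) ^ 2 * b ≤ 3 * (c + 2) ^ 2 * (2 * q) := Nat.mul_le_mul_left _ hb
  have e3 : 2 * (c + 2) * d ≤ 2 * (c + 2) * (2 * q) := Nat.mul_le_mul_left _ hd
  have e4 : 3 * (c + 2) ^ 2 * q ≤ 3 * (c + 2) ^ 2 * c := Nat.mul_le_mul_left _ hq
  have e5 : 2 * (c + 2) * q ≤ 2 * (c + 2) * c := Nat.mul_le_mul_left _ hq
  have e6 : (2 * q + 1) * (c + 1) ≤ (2 * c + 1) * (c + 1) := Nat.mul_le_mul_right _ (by omega)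
  have e7 : 3 * (c + 2) ^ 2 * c + 2 * (c + 2) * c + (2 * c + 1) * (c + 1) <
      4 * (c + 2) ^ 3 := by nlinarith [Nat.zero_le (c ^ 3), Nat.zero_le (c ^ 2)]
  linarith

lemma value_lt_of_few_hubClique {C N q a b d t : ℕ} (hC : q + 2 ≤ C) (ha : a ≤ N)
    (hb : b < q) (hbd : d + b ≤ 2 * q) (ht : t ≤ (2 * q + 1) * (C - 1)) :
    4 * C ^ 3 * a + 3 * C ^ 2 * b + 2 * C * d + t <
      4 * C ^ 3 * N + 3 * C ^ 2 * q + 2 * C * q := by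
  obtain ⟨c, rfl⟩ : ∃ c, C = c + 2 := ⟨C - 2, by omega⟩
  obtain ⟨r, rfl⟩ : ∃ r, q = b + 1 + r := ⟨q - b - 1, by omega⟩
  replace ht : t ≤ (2 * (b + 1 + r) + 1) * (c + 1) := ht
  have e1 : 4 * (c + 2) ^ 3 * a ≤ 4 * (c + 2) ^ 3 * N := Nat.mul_le_mul_left _ ha
  have e3 : 2 * (c + 2) * d ≤ 2 * (c + 2) * ((b + 1 + r) + (r + 1)) :=
    Nat.mul_le_mul_left _ (by omega)
  have e6 : (2 * (b + 1 + r) + 1) * (c + 1) ≤ (2 * c + 1) * (c + 1) :=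
    Nat.mul_le_mul_right _ (by omega)
  have e7 : 2 * (c + 2) * r ≤ 3 * (c + 2) ^ 2 * r :=
    Nat.mul_le_mul_right _ (by nlinarith)
  have e8 : (2 * c + 1) * (c + 1) + 2 * (c + 2) < 3 * (c + 2) ^ 2 := by nlinarith
  linarith

lemma eq_zero_of_exchange {C N a d r s t t' : ℕ} {q : ℕ} (hC : 1 ≤ C) (ha : a ≤ N)
    (hq : d + r = q) (hs : s ≤ r) (ht : t ≤ t' + (r + s) * (C - 1))
    (h : 4 * C ^ 3 * N + 3 * C ^ 2 * q + 2 * C * q + t' ≤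
      4 * C ^ 3 * a + 3 * C ^ 2 * q + 2 * C * d + t) : r = 0 := by
  obtain ⟨c, rfl⟩ : ∃ c, C = c + 1 := ⟨C - 1, by omega⟩
  subst hq
  replace ht : t ≤ t' + (r + s) * c := ht
  have e1 : 4 * (c + 1) ^ 3 * a ≤ 4 * (c + 1) ^ 3 * N := Nat.mul_le_mul_left _ ha
  have e2 : (r + s) * c ≤ (r + r) * c := Nat.mul_le_mul_right _ (by omega)
  nlinarith

section Construction

variable {k m : ℕ} {H : SimpleGraph (Fin k × Fin (2 ^ m))}

/-- A vertex of some `V^i`. -/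
abbrev cliqueVtx (b : Fin k × Fin m × Bool) : MCVtx k m H := Sum.inl b

/-- The vertex `u_i`. -/
abbrev hubVtx (i : Fin k) : MCVtx k m H := Sum.inr (Sum.inl i)

/-- A vertex of some `I_i`. -/
abbrev leafVtx (z : Fin k × Fin (cap k m - m - 1)) : MCVtx k m H :=
  Sum.inr (Sum.inr (Sum.inl z))

/-- The vertex `v_e`. -/
abbrev edgeVtx (e : {e : Sym2 (Fin k × Fin (2 ^ m)) // e ∈ H.edgeSet}) : MCVtx k m H :=
  Sum.inr (Sum.inr (Sum.inr (Sum.inl e)))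

variable (H) in
/-- The vertex `x`. -/
abbrev apexVtx : MCVtx k m H := Sum.inr (Sum.inr (Sum.inr (Sum.inr ())))

lemma mcGraph_edge_cases (e : Sym2 (MCVtx k m H)) (he : e ∈ (mcGraph k m H).edgeSet) :
    (∃ z, e = s(hubVtx z.1, leafVtx z)) ∨ (∃ b, e = s(hubVtx b.1, cliqueVtx b)) ∨
      (∃ b, e = s(apexVtx H, cliqueVtx b)) ∨
      (mcW k m H e = 1 ∧
        ((∃ b c, b.1 = c.1 ∧ e = s(cliqueVtx b, cliqueVtx c)) ∨
          (∃ b ε, e = s(cliqueVtx b, edgeVtx ε)) ∨ (∃ ε, e = s(apexVtx H, edgeVtx ε)))) := by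
  induction e using Sym2.ind with
  | _ p q =>
    replace he : mcR k m H p q ∨ mcR k m H q p := he
    rcases p with b | i | z | ε | u <;> rcases q with c | j | y | δ | v <;>
      simp only [mcR, or_self, or_false, false_or] at he
    · refine Or.inr (Or.inr (Or.inr ⟨rfl, Or.inl ⟨b, c, ?_, rfl⟩⟩))
      exact he.elim (fun h => h.1) (fun h => h.1.symm)
    · subst he
      exact Or.inr (Or.inl ⟨b, Sym2.eq_swap⟩)
    · exact Or.inr (Or.inr (Or.inr ⟨rfl, Or.inr (Or.inl ⟨b, δ, rfl⟩)⟩))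
    · exact Or.inr (Or.inr (Or.inl ⟨b, Sym2.eq_swap⟩))
    · subst he
      exact Or.inr (Or.inl ⟨c, rfl⟩)
    · subst he
      exact Or.inl ⟨y, rfl⟩
    · subst he
      exact Or.inl ⟨z, Sym2.eq_swap⟩
    · exact Or.inr (Or.inr (Or.inr ⟨rfl, Or.inr (Or.inl ⟨c, ε, Sym2.eq_swap⟩)⟩))
    · exact Or.inr (Or.inr (Or.inr ⟨rfl, Or.inr (Or.inr ⟨ε, Sym2.eq_swap⟩)⟩))
    · exact Or.inr (Or.inr (Or.inl ⟨c, rfl⟩))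
    · exact Or.inr (Or.inr (Or.inr ⟨rfl, Or.inr (Or.inr ⟨δ, rfl⟩)⟩))

lemma hub_leaf_mem (z : Fin k × Fin (cap k m - m - 1)) :
    s(hubVtx z.1, leafVtx z) ∈ (mcGraph k m H).edgeSet := by
  simp [mcGraph, mcR]

lemma hub_clique_mem (b : Fin k × Fin m × Bool) :
    s(hubVtx b.1, cliqueVtx b) ∈ (mcGraph k m H).edgeSet := by
  simp [mcGraph, mcR]

lemma apex_clique_mem (b : Fin k × Fin m × Bool) :
    s(apexVtx H, cliqueVtx b) ∈ (mcGraph k m H).edgeSet := by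
  simp [mcGraph, mcR]

/-- The leaves lying in the same fibre as their hub. -/
noncomputable def hubLeaves {L : Type*} (f : MCVtx k m H → L) :
    Finset (Fin k × Fin (cap k m - m - 1)) :=
  Finset.univ.filter (fun z => f (hubVtx z.1) = f (leafVtx z))

/-- The clique vertices lying in the same fibre as their hub. -/
noncomputable def hubClique {L : Type*} (f : MCVtx k m H → L) :
    Finset (Fin k × Fin m × Bool) :=
  Finset.univ.filter (fun b => f (hubVtx b.1) = f (cliqueVtx b))

/-- The clique vertices lying in the same fibre as the apex. -/
noncomputable def apexClique {L : Type*} (f : MCVtx k m H → L) :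
    Finset (Fin k × Fin m × Bool) :=
  Finset.univ.filter (fun b => f (apexVtx H) = f (cliqueVtx b))

/-- The edges of weight `1` inside the fibres of `f`. -/
noncomputable def lightEdges {L : Type*} (f : MCVtx k m H → L) :
    Finset (Sym2 (MCVtx k m H)) :=
  (monoEdges (mcGraph k m H) f).filter (fun e => mcW k m H e = 1)

lemma four_le_cap (hk : 2 ≤ k) (hm : 1 ≤ m) : 4 ≤ cap k m := by
  have h1 : 1 ≤ k * (k - 1) / 2 := by
    rw [Nat.le_div_iff_mul_le (by norm_num)]
    have : 1 ≤ k - 1 := by omega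
    nlinarith
  have h2 : 2 * 1 ≤ k * m := Nat.mul_le_mul hk hm
  unfold cap; omega

lemma mul_add_two_le_cap (hk : 2 ≤ k) : k * m + 2 ≤ cap k m := by
  have h1 : 1 ≤ k * (k - 1) / 2 := by
    rw [Nat.le_div_iff_mul_le (by norm_num)]
    have : 1 ≤ k - 1 := by omega
    nlinarith
  unfold cap; omega

lemma value_eq (hC : 4 ≤ cap k m) {L : Type*} (f : MCVtx k m H → L) :
    ∑ e ∈ monoEdges (mcGraph k m H) f, mcW k m H e =
      4 * cap k m ^ 3 * (hubLeaves f).card + 3 * cap k m ^ 2 * (hubClique f).card +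
        2 * cap k m * (apexClique f).card + (lightEdges f).card := by
  set S1 : Finset (Sym2 (MCVtx k m H)) :=
    (hubLeaves f).image (fun z => s(hubVtx z.1, leafVtx z)) with hS1
  set S2 : Finset (Sym2 (MCVtx k m H)) :=
    (hubClique f).image (fun b => s(hubVtx b.1, cliqueVtx b)) with hS2
  set S3 : Finset (Sym2 (MCVtx k m H)) :=
    (apexClique f).image (fun b => s(apexVtx H, cliqueVtx b)) with hS3
  have c1 : S1.card = (hubLeaves f).card :=
    Finset.card_image_of_injective _ fun a b h => (by simpa using h : a.1 = b.1 ∧ a = b).2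
  have c2 : S2.card = (hubClique f).card :=
    Finset.card_image_of_injective _ fun a b h => (by simpa using h : a.1 = b.1 ∧ a = b).2
  have c3 : S3.card = (apexClique f).card :=
    Finset.card_image_of_injective _ fun a b h => by simpa using h
  have w1 : ∀ e ∈ S1, mcW k m H e = 4 * cap k m ^ 3 := by
    intro e he
    obtain ⟨z, -, rfl⟩ := Finset.mem_image.1 he
    rfl
  have w2 : ∀ e ∈ S2, mcW k m H e = 3 * cap k m ^ 2 := by
    intro e he
    obtain ⟨z, -, rfl⟩ := Finset.mem_image.1 he
    rfl
  have w3 : ∀ e ∈ S3, mcW k m H e = 2 * cap k m := by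
    intro e he
    obtain ⟨z, -, rfl⟩ := Finset.mem_image.1 he
    rfl
  have w4 : ∀ e ∈ lightEdges f, mcW k m H e = 1 := fun e he => (Finset.mem_filter.1 he).2
  have hsq : cap k m ≤ cap k m ^ 2 := Nat.le_self_pow (by norm_num) _
  have hcu : cap k m ^ 2 ≤ cap k m ^ 3 := Nat.pow_le_pow_right (by omega) (by norm_num)
  have hunion : monoEdges (mcGraph k m H) f = ((S1 ∪ S2) ∪ S3) ∪ lightEdges f := by
    ext e
    constructor
    · intro he
      have hm := mem_monoEdges.1 he
      rcases mcGraph_edge_cases e hm.1 with ⟨z, rfl⟩ | ⟨z, rfl⟩ | ⟨z, rfl⟩ | ⟨h, -⟩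
      · have hz : z ∈ hubLeaves f := by simpa [hubLeaves] using hm.2
        exact Finset.mem_union_left _ (Finset.mem_union_left _ (Finset.mem_union_left _
          (Finset.mem_image_of_mem _ hz)))
      · have hz : z ∈ hubClique f := by simpa [hubClique] using hm.2
        exact Finset.mem_union_left _ (Finset.mem_union_left _ (Finset.mem_union_right _
          (Finset.mem_image_of_mem _ hz)))
      · have hz : z ∈ apexClique f := by simpa [apexClique] using hm.2
        exact Finset.mem_union_left _ (Finset.mem_union_right _
          (Finset.mem_image_of_mem _ hz))
      · exact Finset.mem_union_right _ (Finset.mem_filter.2 ⟨he, h⟩)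
    · intro he
      simp only [Finset.mem_union] at he
      rcases he with ((he | he) | he) | he
      · obtain ⟨z, hz, rfl⟩ := Finset.mem_image.1 he
        exact mem_monoEdges.2 ⟨hub_leaf_mem z, by simpa [hubLeaves] using hz⟩
      · obtain ⟨z, hz, rfl⟩ := Finset.mem_image.1 he
        exact mem_monoEdges.2 ⟨hub_clique_mem z, by simpa [hubClique] using hz⟩
      · obtain ⟨z, hz, rfl⟩ := Finset.mem_image.1 he
        exact mem_monoEdges.2 ⟨apex_clique_mem z, by simpa [apexClique] using hz⟩
      · exact (Finset.mem_filter.1 he).1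
  have d1 : Disjoint S1 S2 := by
    rw [Finset.disjoint_left]
    intro e h h'
    obtain ⟨z, -, rfl⟩ := Finset.mem_image.1 h
    obtain ⟨y, -, hy⟩ := Finset.mem_image.1 h'
    simp at hy
  have d2 : Disjoint (S1 ∪ S2) S3 := by
    rw [Finset.disjoint_left]
    intro e h h'
    obtain ⟨y, -, rfl⟩ := Finset.mem_image.1 h'
    rcases Finset.mem_union.1 h with h | h <;>
    · obtain ⟨z, -, hz⟩ := Finset.mem_image.1 h
      simp at hz
  have d3 : Disjoint ((S1 ∪ S2) ∪ S3) (lightEdges f) := by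
    rw [Finset.disjoint_left]
    intro e h h'
    have := w4 e h'
    simp only [Finset.mem_union] at h
    rcases h with (h | h) | h
    · have := w1 e h; omega
    · have := w2 e h; omega
    · have := w3 e h; omega
  rw [hunion, Finset.sum_union d3, Finset.sum_union d2, Finset.sum_union d1,
    Finset.sum_congr rfl w1, Finset.sum_congr rfl w2, Finset.sum_congr rfl w3,
    Finset.sum_congr rfl w4]
  simp only [Finset.sum_const, smul_eq_mul, c1, c2, c3, mul_one]
  ring

lemma card_lightEdges_le {L : Type*} (f : MCVtx k m H → L)
    (hf : ∀ y, (Finset.univ.filter (fun v => f v = y)).card ≤ cap k m) :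
    (lightEdges f).card ≤ (2 * (k * m) + 1) * (cap k m - 1) := by
  set Y : Finset (MCVtx k m H) := insert (apexVtx H) (Finset.univ.image cliqueVtx) with hYdef
  have hY : Y.card ≤ 2 * (k * m) + 1 := by
    refine (Finset.card_insert_le _ _).trans (Nat.succ_le_succ (Finset.card_image_le.trans ?_))
    simp only [Finset.card_univ, Fintype.card_prod, Fintype.card_fin, Fintype.card_bool]
    exact le_of_eq (by ring)
  refine (card_le_of_touching _ f _ hf _ (Finset.filter_subset _ _) Y ?_).trans
    (Nat.mul_le_mul_right _ hY)
  intro e he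
  obtain ⟨he, hw⟩ := Finset.mem_filter.1 he
  rcases mcGraph_edge_cases e (mem_monoEdges.1 he).1 with
    ⟨z, rfl⟩ | ⟨z, rfl⟩ | ⟨z, rfl⟩ | ⟨-, ⟨b, c, -, rfl⟩ | ⟨b, ε, rfl⟩ | ⟨ε, rfl⟩⟩
  · have hw' : 4 * cap k m ^ 3 = 1 := hw
    omega
  · exact ⟨cliqueVtx z, by simp [Y], by simp⟩
  · exact ⟨cliqueVtx z, by simp [Y], by simp⟩
  · exact ⟨cliqueVtx b, by simp [Y], by simp⟩
  · exact ⟨cliqueVtx b, by simp [Y], by simp⟩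
  · exact ⟨apexVtx H, by simp [Y], by simp⟩

lemma card_clique_row (i : Fin k) :
    (Finset.univ.filter (fun b : Fin k × Fin m × Bool => b.1 = i)).card = 2 * m := by
  have : Finset.univ.filter (fun b : Fin k × Fin m × Bool => b.1 = i) =
      (Finset.univ : Finset (Fin m × Bool)).image (fun c => (i, c)) := by
    ext ⟨j, c⟩
    simp [eq_comm]
  rw [this, Finset.card_image_of_injective _ fun a b h => by simpa using h]
  simp [mul_comm]

lemma card_eq_sum_rows (T : Finset (Fin k × Fin m × Bool)) :
    T.card = ∑ i : Fin k, (T.filter (fun b => b.1 = i)).card :=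
  Finset.card_eq_sum_card_fiberwise fun _ _ => Finset.mem_univ _

/-- The labelling that puts `u_i` together with `I_i` and the vertices of `T` in `V^i`, and the
apex together with the other clique vertices and the vertices `v_e` with `e ∈ F`. -/
noncomputable def refLabel (T : Finset (Fin k × Fin m × Bool))
    (F : Finset {e : Sym2 (Fin k × Fin (2 ^ m)) // e ∈ H.edgeSet}) :
    MCVtx k m H → MCVtx k m H
  | Sum.inl b => if b ∈ T then hubVtx b.1 else apexVtx H
  | Sum.inr (Sum.inl i) => hubVtx i
  | Sum.inr (Sum.inr (Sum.inl z)) => hubVtx z.1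
  | Sum.inr (Sum.inr (Sum.inr (Sum.inl e))) => if e ∈ F then apexVtx H else edgeVtx e
  | Sum.inr (Sum.inr (Sum.inr (Sum.inr _))) => apexVtx H

lemma card_compl_of_rows {T : Finset (Fin k × Fin m × Bool)} (hT : T.card = k * m) :
    Tᶜ.card = k * m := by
  rw [Finset.card_compl, hT]
  simp only [Fintype.card_prod, Fintype.card_fin, Fintype.card_bool]
  have : k * (m * 2) = k * m + k * m := by ring
  omega

lemma card_of_rows {T : Finset (Fin k × Fin m × Bool)}
    (hT : ∀ i, (T.filter (fun b => b.1 = i)).card = m) : T.card = k * m := by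
  rw [card_eq_sum_rows, Finset.sum_congr rfl fun i _ => hT i]
  simp

lemma card_refLabel_fibre (hk : 2 ≤ k) (hm : 1 ≤ m) {T : Finset (Fin k × Fin m × Bool)}
    (hT : ∀ i, (T.filter (fun b => b.1 = i)).card = m)
    {F : Finset {e : Sym2 (Fin k × Fin (2 ^ m)) // e ∈ H.edgeSet}}
    (hF : F.card ≤ k * (k - 1) / 2) (y : MCVtx k m H) :
    (Finset.univ.filter (fun v => refLabel T F v = y)).card ≤ cap k m := by
  have hC := four_le_cap hk hm
  have hC' := mul_add_two_le_cap (m := m) hk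
  have hkm : 2 * m ≤ k * m := Nat.mul_le_mul_right _ hk
  rcases y with b | i | z | e | u
  · rw [Finset.filter_false_of_mem]
    · simp
    · rintro (v | v | v | v | v) - <;> simp only [refLabel] <;> (try split_ifs) <;> simp
  · have hsub : Finset.univ.filter (fun v => refLabel T F v = hubVtx i) ⊆
        insert (hubVtx i) ((Finset.univ.image (fun j => leafVtx (i, j))) ∪
          (T.filter (fun b => b.1 = i)).image cliqueVtx) := by
      rintro (v | v | v | v | v) hv <;>
        replace hv := (Finset.mem_filter.1 hv).2 <;> simp only [refLabel] at hv
      · split_ifs at hv with h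
        · simp at hv; simp [hv, h]
        · simp at hv
      · simp at hv; simp [hv]
      · obtain ⟨v1, v2⟩ := v
        simp at hv; simp [hv]
      · split_ifs at hv <;> simp at hv
      · simp at hv
    refine (Finset.card_le_card hsub).trans ((Finset.card_insert_le _ _).trans ?_)
    refine (Nat.succ_le_succ ((Finset.card_union_le _ _).trans
      (Nat.add_le_add Finset.card_image_le Finset.card_image_le))).trans ?_
    rw [hT]
    simp only [Finset.card_univ, Fintype.card_fin]
    omega
  · rw [Finset.filter_false_of_mem]
    · simp
    · rintro (v | v | v | v | v) - <;> simp only [refLabel] <;> (try split_ifs) <;> simp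
  · have hsub : Finset.univ.filter (fun v => refLabel T F v = edgeVtx e) ⊆ {edgeVtx e} := by
      rintro (v | v | v | v | v) hv <;>
        replace hv := (Finset.mem_filter.1 hv).2 <;> simp only [refLabel] at hv <;>
        (try split_ifs at hv) <;> simp at hv ⊢
      exact hv
    refine (Finset.card_le_card hsub).trans ?_
    simp only [Finset.card_singleton]
    omega
  · have hsub : Finset.univ.filter (fun v => refLabel T F v = apexVtx H) ⊆
        insert (apexVtx H) ((Tᶜ.image cliqueVtx) ∪ F.image edgeVtx) := by
      rintro (v | v | v | v | v) hv <;>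
        replace hv := (Finset.mem_filter.1 hv).2 <;> simp only [refLabel] at hv
      · split_ifs at hv with h
        · simp at hv
        · simp [h]
      · simp at hv
      · simp at hv
      · split_ifs at hv with h
        · simpa using h
        · simp at hv
      · simp
    refine (Finset.card_le_card hsub).trans ((Finset.card_insert_le _ _).trans ?_)
    refine (Nat.succ_le_succ ((Finset.card_union_le _ _).trans
      (Nat.add_le_add Finset.card_image_le Finset.card_image_le))).trans ?_
    rw [card_compl_of_rows (card_of_rows hT)]
    unfold cap
    omega

lemma value_refLabel (hk : 2 ≤ k) (hm : 1 ≤ m) {T : Finset (Fin k × Fin m × Bool)}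
    (hT : T.card = k * m) (F : Finset {e : Sym2 (Fin k × Fin (2 ^ m)) // e ∈ H.edgeSet}) :
    ∑ e ∈ monoEdges (mcGraph k m H) (refLabel T F), mcW k m H e =
      4 * cap k m ^ 3 * (k * (cap k m - m - 1)) + 3 * cap k m ^ 2 * (k * m) +
        2 * cap k m * (k * m) + (lightEdges (refLabel T F)).card := by
  rw [value_eq (four_le_cap hk hm)]
  have h1 : hubLeaves (refLabel T F) = Finset.univ := by
    ext z; simp [hubLeaves, refLabel]
  have h2 : hubClique (refLabel T F) = T := by
    ext b
    simp only [hubClique, Finset.mem_filter, Finset.mem_univ, true_and]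
    simp only [refLabel]
    split_ifs with h <;> simp [h]
  have h3 : apexClique (refLabel T F) = Tᶜ := by
    ext b
    simp only [apexClique, Finset.mem_filter, Finset.mem_univ, true_and, Finset.mem_compl]
    simp only [refLabel]
    split_ifs with h <;> simp [h]
  rw [h1, h2, h3, hT, card_compl_of_rows hT]
  simp

/-- The edges of weight `1` lost when passing from `f` to the reference labelling built from
`hubClique f` touch a clique vertex outside the apex fibre or a discarded `v_e`. -/
lemma card_lightEdges_le_refLabel {L : Type*} (f : MCVtx k m H → L)
    (hf : ∀ y, (Finset.univ.filter (fun v => f v = y)).card ≤ cap k m)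
    (hhub : ∀ i ε, f (edgeVtx ε) ≠ f (hubVtx i))
    (F : Finset {e : Sym2 (Fin k × Fin (2 ^ m)) // e ∈ H.edgeSet}) :
    (lightEdges f).card ≤ (lightEdges (refLabel (hubClique f) F)).card +
      ((Finset.univ.filter (fun b => b ∉ hubClique f ∧ b ∉ apexClique f)).card +
        (Finset.univ.filter (fun ε => f (edgeVtx ε) = f (apexVtx H) ∧ ε ∉ F)).card) *
          (cap k m - 1) := by
  set D := Finset.univ.filter (fun b => b ∉ hubClique f ∧ b ∉ apexClique f) with hD
  set K := Finset.univ.filter (fun ε => f (edgeVtx ε) = f (apexVtx H) ∧ ε ∉ F) with hK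
  have key := card_le_of_touching (mcGraph k m H) f _ hf
    (lightEdges f \ lightEdges (refLabel (hubClique f) F))
    (Finset.sdiff_subset.trans (Finset.filter_subset _ _))
    (D.image cliqueVtx ∪ K.image edgeVtx) ?_
  · have h1 := Finset.card_le_card_sdiff_add_card
      (t := lightEdges (refLabel (hubClique f) F)) (s := lightEdges f)
    have h2 : (D.image (cliqueVtx (H := H)) ∪ K.image edgeVtx).card ≤ D.card + K.card :=
      (Finset.card_union_le _ _).trans
        (Nat.add_le_add Finset.card_image_le Finset.card_image_le)
    have h3 := Nat.mul_le_mul_right (cap k m - 1) h2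
    omega
  · intro e he
    obtain ⟨he, hne⟩ := Finset.mem_sdiff.1 he
    obtain ⟨he, hw⟩ := Finset.mem_filter.1 he
    obtain ⟨hG, hmono⟩ := mem_monoEdges.1 he
    have hne' : ¬ (e.map (refLabel (hubClique f) F)).IsDiag := fun h =>
      hne (Finset.mem_filter.2 ⟨mem_monoEdges.2 ⟨hG, h⟩, hw⟩)
    rcases mcGraph_edge_cases e hG with
      ⟨z, rfl⟩ | ⟨z, rfl⟩ | ⟨z, rfl⟩ | ⟨-, ⟨b, c, hbc, rfl⟩ | ⟨b, ε, rfl⟩ | ⟨ε, rfl⟩⟩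
    · exact absurd (by simp [refLabel]) hne'
    · simp only [Sym2.map_mk, Sym2.mk_isDiag_iff] at hmono hne'
      exact absurd (by simp [refLabel, hubClique, hmono]) hne'
    · simp only [Sym2.map_mk, Sym2.mk_isDiag_iff, refLabel] at hmono hne'
      have hw' : 2 * cap k m = 1 := hw
      omega
    · simp only [Sym2.map_mk, Sym2.mk_isDiag_iff, refLabel] at hmono hne'
      have : b ∈ hubClique f ↔ c ∈ hubClique f := by
        simp [hubClique, hbc, hmono]
      exact absurd (by simp [this, hbc]) hne'
    · simp only [Sym2.map_mk, Sym2.mk_isDiag_iff, refLabel] at hmono hne'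
      have hb : b ∉ hubClique f := by
        intro hb
        have hb' : f (hubVtx b.1) = f (cliqueVtx b) := by simpa [hubClique] using hb
        exact hhub b.1 ε (hmono.symm.trans hb'.symm)
      by_cases hx : b ∈ apexClique f
      · have hx' : f (apexVtx H) = f (cliqueVtx b) := by simpa [apexClique] using hx
        refine ⟨edgeVtx ε, Finset.mem_union_right _ (Finset.mem_image_of_mem _ ?_), by simp⟩
        refine Finset.mem_filter.2 ⟨Finset.mem_univ _, hmono.symm.trans hx'.symm, ?_⟩
        intro hε
        simp [hb, hε] at hne'
      · exact ⟨cliqueVtx b, Finset.mem_union_left _ (Finset.mem_image_of_mem _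
          (Finset.mem_filter.2 ⟨Finset.mem_univ _, hb, hx⟩)), by simp⟩
    · simp only [Sym2.map_mk, Sym2.mk_isDiag_iff, refLabel] at hmono hne'
      refine ⟨edgeVtx ε, Finset.mem_union_right _ (Finset.mem_image_of_mem _ ?_), by simp⟩
      refine Finset.mem_filter.2 ⟨Finset.mem_univ _, hmono.symm, ?_⟩
      intro hε
      simp [hε] at hne'

/-- If every hub is together with all its leaves, then at most `m` further vertices share its
fibre. -/
lemma card_le_of_hub_full (hk : 2 ≤ k) {L : Type*} (f : MCVtx k m H → L)
    (hf : ∀ y, (Finset.univ.filter (fun v => f v = y)).card ≤ cap k m)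
    (hfull : ∀ z, f (hubVtx z.1) = f (leafVtx z)) (i : Fin k) (R : Finset (MCVtx k m H))
    (hR : ∀ v ∈ R, f v = f (hubVtx i) ∧ v ≠ hubVtx i ∧ ∀ j, v ≠ leafVtx (i, j)) :
    R.card ≤ m := by
  set J : Finset (MCVtx k m H) := Finset.univ.image (fun j => leafVtx (i, j)) with hJ
  have hJc : J.card = cap k m - m - 1 := by
    rw [hJ, Finset.card_image_of_injective _ fun a b h => by simpa using h]
    simp
  have hd1 : Disjoint R J := by
    rw [Finset.disjoint_left]
    intro v hv hvJ
    obtain ⟨j, -, rfl⟩ := Finset.mem_image.1 hvJ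
    exact (hR _ hv).2.2 j rfl
  have hd2 : hubVtx i ∉ R ∪ J := by
    intro h
    rcases Finset.mem_union.1 h with h | h
    · exact (hR _ h).2.1 rfl
    · simp [hJ] at h
  have hsub : insert (hubVtx i) (R ∪ J) ⊆ Finset.univ.filter (fun v => f v = f (hubVtx i)) := by
    intro v hv
    simp only [Finset.mem_filter, Finset.mem_univ, true_and]
    rcases Finset.mem_insert.1 hv with rfl | hv
    · rfl
    rcases Finset.mem_union.1 hv with hv | hv
    · exact (hR v hv).1
    · obtain ⟨j, -, rfl⟩ := Finset.mem_image.1 hv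
      exact (hfull (i, j)).symm
  have h := (Finset.card_le_card hsub).trans (hf _)
  rw [Finset.card_insert_of_notMem hd2, Finset.card_union_of_disjoint hd1, hJc] at h
  have hC' := mul_add_two_le_cap (m := m) hk
  have hkm : 2 * m ≤ k * m := Nat.mul_le_mul_right _ hk
  omega

lemma card_cliqueVtx_image (S : Finset (Fin k × Fin m × Bool)) :
    (S.image (cliqueVtx (H := H))).card = S.card :=
  Finset.card_image_of_injective _ Sum.inl_injective

lemma card_apexClique_add_card_hubClique_le (hk : 2 ≤ k) {L : Type*} (f : MCVtx k m H → L)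
    (hf : ∀ y, (Finset.univ.filter (fun v => f v = y)).card ≤ cap k m)
    (hfull : ∀ z, f (hubVtx z.1) = f (leafVtx z)) (hb : (hubClique f).card ≤ k * m) :
    (apexClique f).card + (hubClique f).card ≤ 2 * (k * m) := by
  by_cases hx : ∃ i, f (apexVtx H) = f (hubVtx i)
  · obtain ⟨i, hi⟩ := hx
    have h := card_le_of_hub_full hk f hf hfull i ((apexClique f).image cliqueVtx) (by
      intro v hv
      obtain ⟨b, hb, rfl⟩ := Finset.mem_image.1 hv
      have hb' : f (apexVtx H) = f (cliqueVtx b) := by simpa [apexClique] using hb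
      exact ⟨hb'.symm.trans hi, by simp, by simp⟩)
    rw [card_cliqueVtx_image] at h
    have hkm : 2 * m ≤ k * m := Nat.mul_le_mul_right _ hk
    omega
  · push Not at hx
    have hd : Disjoint (apexClique f) (hubClique f) := by
      rw [Finset.disjoint_left]
      intro b hb hb'
      simp only [apexClique, hubClique, Finset.mem_filter, Finset.mem_univ, true_and] at hb hb'
      exact hx b.1 (hb.trans hb'.symm)
    rw [← Finset.card_union_of_disjoint hd]
    refine (Finset.card_le_univ _).trans (le_of_eq ?_)
    simp only [Fintype.card_prod, Fintype.card_fin, Fintype.card_bool]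
    ring

lemma card_hubClique_row_le (hk : 2 ≤ k) {L : Type*} (f : MCVtx k m H → L)
    (hf : ∀ y, (Finset.univ.filter (fun v => f v = y)).card ≤ cap k m)
    (hfull : ∀ z, f (hubVtx z.1) = f (leafVtx z)) (i : Fin k) :
    ((hubClique f).filter (fun b => b.1 = i)).card ≤ m := by
  rw [← card_cliqueVtx_image (H := H)]
  refine card_le_of_hub_full hk f hf hfull i _ ?_
  intro v hv
  obtain ⟨b, hb, rfl⟩ := Finset.mem_image.1 hv
  obtain ⟨hb, rfl⟩ := Finset.mem_filter.1 hb
  have hb' : f (hubVtx b.1) = f (cliqueVtx b) := by simpa [hubClique] using hb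
  exact ⟨hb'.symm, by simp, by simp⟩

/-- When a hub is together with its leaves and `m` of its clique vertices, nothing else fits. -/
lemma ne_hub_of_row_full (hk : 2 ≤ k) {L : Type*} (f : MCVtx k m H → L)
    (hf : ∀ y, (Finset.univ.filter (fun v => f v = y)).card ≤ cap k m)
    (hfull : ∀ z, f (hubVtx z.1) = f (leafVtx z)) (i : Fin k)
    (hrow : ((hubClique f).filter (fun b => b.1 = i)).card = m) (v : MCVtx k m H)
    (hv1 : v ≠ hubVtx i) (hv2 : ∀ j, v ≠ leafVtx (i, j)) (hv3 : ∀ b, v ≠ cliqueVtx b) :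
    f v ≠ f (hubVtx i) := by
  intro hv
  have h := card_le_of_hub_full hk f hf hfull i
    (insert v (((hubClique f).filter (fun b => b.1 = i)).image cliqueVtx)) (by
      intro y hy
      rcases Finset.mem_insert.1 hy with rfl | hy
      · exact ⟨hv, hv1, hv2⟩
      · obtain ⟨b, hb, rfl⟩ := Finset.mem_image.1 hy
        obtain ⟨hb, rfl⟩ := Finset.mem_filter.1 hb
        have hb' : f (hubVtx b.1) = f (cliqueVtx b) := by simpa [hubClique] using hb
        exact ⟨hb'.symm, by simp, by simp⟩)
  rw [Finset.card_insert_of_notMem, card_cliqueVtx_image, hrow] at h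
  · omega
  · intro hmem
    obtain ⟨b, -, hb⟩ := Finset.mem_image.1 hmem
    exact hv3 b hb.symm

/-- An optimal labelling keeps every hub together with all its leaves. -/
lemma hub_full_of_optimal (hk : 2 ≤ k) (hm : 1 ≤ m) {L : Type*} (f : MCVtx k m H → L)
    (hf : ∀ y, (Finset.univ.filter (fun v => f v = y)).card ≤ cap k m)
    (hlow : 4 * cap k m ^ 3 * (k * (cap k m - m - 1)) + 3 * cap k m ^ 2 * (k * m) +
        2 * cap k m * (k * m) ≤ ∑ e ∈ monoEdges (mcGraph k m H) f, mcW k m H e)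
    (z : Fin k × Fin (cap k m - m - 1)) : f (hubVtx z.1) = f (leafVtx z) := by
  rw [value_eq (four_le_cap hk hm)] at hlow
  have hC' := mul_add_two_le_cap (m := m) hk
  have hE := card_lightEdges_le f hf
  have hB : (hubClique f).card ≤ 2 * (k * m) := by
    refine (Finset.card_le_univ _).trans (le_of_eq ?_)
    simp only [Fintype.card_prod, Fintype.card_fin, Fintype.card_bool]
    ring
  have hD : (apexClique f).card ≤ 2 * (k * m) := by
    refine (Finset.card_le_univ _).trans (le_of_eq ?_)
    simp only [Fintype.card_prod, Fintype.card_fin, Fintype.card_bool]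
    ring
  by_contra hz
  have hA : (hubLeaves f).card < k * (cap k m - m - 1) := by
    have : hubLeaves f ⊂ Finset.univ :=
      Finset.filter_ssubset.2 ⟨z, Finset.mem_univ _, hz⟩
    simpa using Finset.card_lt_card this
  exact absurd hlow (not_le.2 (value_lt_of_few_hubLeaves hC' hA hB hD hE))

/-- An optimal labelling puts `m` clique vertices with every hub. -/
lemma card_hubClique_of_optimal (hk : 2 ≤ k) (hm : 1 ≤ m) {L : Type*} (f : MCVtx k m H → L)
    (hf : ∀ y, (Finset.univ.filter (fun v => f v = y)).card ≤ cap k m)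
    (hlow : 4 * cap k m ^ 3 * (k * (cap k m - m - 1)) + 3 * cap k m ^ 2 * (k * m) +
        2 * cap k m * (k * m) ≤ ∑ e ∈ monoEdges (mcGraph k m H) f, mcW k m H e) (i : Fin k) :
    ((hubClique f).filter (fun b => b.1 = i)).card = m := by
  have hfull := hub_full_of_optimal hk hm f hf hlow
  have hrow := card_hubClique_row_le hk f hf hfull
  refine le_antisymm (hrow i) ?_
  by_contra hi
  push Not at hi
  have hB : (hubClique f).card < k * m := by
    rw [card_eq_sum_rows]
    have := Finset.sum_lt_sum (fun i _ => hrow i) ⟨i, Finset.mem_univ i, hi⟩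
    simpa using this
  have hBD := card_apexClique_add_card_hubClique_le hk f hf hfull hB.le
  rw [value_eq (four_le_cap hk hm)] at hlow
  have hC' := mul_add_two_le_cap (m := m) hk
  have hE := card_lightEdges_le f hf
  have hA : (hubLeaves f).card ≤ k * (cap k m - m - 1) := by
    simpa using Finset.card_le_univ (hubLeaves f)
  exact absurd hlow (not_le.2 (value_lt_of_few_hubClique hC' hA hB hBD hE))

lemma card_false_row (i : Fin k) :
    ((Finset.univ.filter (fun b : Fin k × Fin m × Bool => b.2.2 = false)).filter
      (fun b => b.1 = i)).card = m := by
  have : (Finset.univ.filter (fun b : Fin k × Fin m × Bool => b.2.2 = false)).filter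
      (fun b => b.1 = i) = Finset.univ.image (fun l : Fin m => (i, l, false)) := by
    ext ⟨j, l, c⟩
    simp only [Finset.mem_filter, Finset.mem_univ, true_and, Finset.mem_image, Prod.mk.injEq]
    constructor
    · rintro ⟨rfl, rfl⟩
      exact ⟨l, rfl, rfl, rfl⟩
    · rintro ⟨-, rfl, -, rfl⟩
      exact ⟨rfl, rfl⟩
  rw [this, Finset.card_image_of_injective _ fun a b h => by simpa using h]
  simp

/-- In an optimal labelling, each `V^i` has exactly `m` vertices in the fibre of the apex. -/
lemma card_apexClique_row_of_optimal (hk : 2 ≤ k) (hm : 1 ≤ m) {L : Type*}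
    (f : MCVtx k m H → L)
    (hf : ∀ y, (Finset.univ.filter (fun v => f v = y)).card ≤ cap k m)
    (hopt : ∀ g : MCVtx k m H → MCVtx k m H,
      (∀ y, (Finset.univ.filter (fun v => g v = y)).card ≤ cap k m) →
      ∑ e ∈ monoEdges (mcGraph k m H) g, mcW k m H e ≤
        ∑ e ∈ monoEdges (mcGraph k m H) f, mcW k m H e) (i : Fin k) :
    ((apexClique f).filter (fun b => b.1 = i)).card = m := by
  have hC := four_le_cap hk hm
  have hlow : 4 * cap k m ^ 3 * (k * (cap k m - m - 1)) + 3 * cap k m ^ 2 * (k * m) +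
      2 * cap k m * (k * m) ≤ ∑ e ∈ monoEdges (mcGraph k m H) f, mcW k m H e := by
    have h := hopt (refLabel (Finset.univ.filter (fun b => b.2.2 = false)) ∅)
      (card_refLabel_fibre hk hm card_false_row (by simp))
    rw [value_refLabel hk hm (card_of_rows card_false_row)] at h
    omega
  have hfull := hub_full_of_optimal hk hm f hf hlow
  have hrow := card_hubClique_of_optimal hk hm f hf hlow
  have hT := card_of_rows hrow
  have hapex : ∀ j, f (apexVtx H) ≠ f (hubVtx j) := fun j =>
    ne_hub_of_row_full hk f hf hfull j (hrow j) _ (by simp) (by simp) (by simp)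
  have hedge : ∀ j ε, f (edgeVtx ε) ≠ f (hubVtx j) := fun j ε =>
    ne_hub_of_row_full hk f hf hfull j (hrow j) _ (by simp) (by simp) (by simp)
  have hdisj : ∀ b, b ∈ apexClique f → b ∉ hubClique f := by
    intro b hb hb'
    simp only [apexClique, hubClique, Finset.mem_filter, Finset.mem_univ, true_and] at hb hb'
    exact hapex b.1 (hb.trans hb'.symm)
  set D := Finset.univ.filter (fun b => b ∉ hubClique f ∧ b ∉ apexClique f) with hD
  have hcount : (apexClique f).card + D.card = k * m := by
    rw [← card_compl_of_rows hT, ← Finset.card_union_of_disjoint]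
    · congr 1
      ext b
      have := hdisj b
      simp only [hD, Finset.mem_union, Finset.mem_filter, Finset.mem_univ, true_and,
        Finset.mem_compl]
      tauto
    · rw [Finset.disjoint_left]
      intro b hb hb'
      exact (Finset.mem_filter.1 hb').2.2 hb
  set W := Finset.univ.filter (fun ε => f (edgeVtx ε) = f (apexVtx H)) with hW
  have hWcard : W.card ≤ k * (k - 1) / 2 + D.card := by
    have hsub : insert (apexVtx H) ((apexClique f).image cliqueVtx ∪ W.image edgeVtx) ⊆
        Finset.univ.filter (fun v => f v = f (apexVtx H)) := by
      intro v hv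
      simp only [Finset.mem_filter, Finset.mem_univ, true_and]
      rcases Finset.mem_insert.1 hv with rfl | hv
      · rfl
      rcases Finset.mem_union.1 hv with hv | hv
      · obtain ⟨b, hb, rfl⟩ := Finset.mem_image.1 hv
        exact (Finset.mem_filter.1 hb).2.symm
      · obtain ⟨b, hb, rfl⟩ := Finset.mem_image.1 hv
        exact (Finset.mem_filter.1 hb).2
    have h := (Finset.card_le_card hsub).trans (hf _)
    rw [Finset.card_insert_of_notMem (by simp), Finset.card_union_of_disjoint,
      card_cliqueVtx_image, Finset.card_image_of_injective _ fun a b h => by simpa using h] at h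
    · unfold cap at h
      omega
    · rw [Finset.disjoint_left]
      intro v hv hv'
      obtain ⟨b, -, rfl⟩ := Finset.mem_image.1 hv
      simp at hv'
  obtain ⟨F, hFW, hFcard⟩ := Finset.exists_subset_card_eq
    (Nat.min_le_left W.card (k * (k - 1) / 2))
  have hK : (Finset.univ.filter (fun ε => f (edgeVtx ε) = f (apexVtx H) ∧ ε ∉ F)).card ≤
      D.card := by
    have : Finset.univ.filter (fun ε => f (edgeVtx ε) = f (apexVtx H) ∧ ε ∉ F) = W \ F := by
      ext ε; simp [hW]
    rw [this, Finset.card_sdiff_of_subset hFW, hFcard]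
    omega
  have hE := card_lightEdges_le_refLabel f hf hedge F
  have hval := hopt (refLabel (hubClique f) F)
    (card_refLabel_fibre hk hm hrow (by rw [hFcard]; exact min_le_right _ _))
  rw [value_refLabel hk hm hT, value_eq hC, hT] at hval
  have hA : (hubLeaves f).card ≤ k * (cap k m - m - 1) := by
    simpa using Finset.card_le_univ (hubLeaves f)
  have hD0 : D.card = 0 :=
    eq_zero_of_exchange (by omega) hA hcount hK hE hval
  have hsplit : (apexClique f).filter (fun b => b.1 = i) =
      (Finset.univ.filter (fun b : Fin k × Fin m × Bool => b.1 = i)) \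
        ((hubClique f).filter (fun b => b.1 = i)) := by
    ext b
    have h1 := hdisj b
    have h2 : b ∉ D := by simp [Finset.card_eq_zero.1 hD0]
    simp only [hD, Finset.mem_filter, Finset.mem_univ, true_and, Finset.mem_sdiff] at h2 ⊢
    tauto
  rw [hsplit, Finset.card_sdiff_of_subset
    (Finset.filter_subset_filter _ (Finset.subset_univ _)), card_clique_row, hrow]
  omega

end Construction

/-- In every optimal 𝒞-partition of `G`, the part containing the apex vertex
`x` contains exactly `m` vertices of `V^i` for every `i`. -/
theorem stmt18 (k m : ℕ) (hk : 2 ≤ k) (hm : 1 ≤ m)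
    (H : SimpleGraph (Fin k × Fin (2 ^ m)))
    (hH : ∀ a b : Fin k × Fin (2 ^ m), H.Adj a b → a.1 ≠ b.1)
    (P : Finpartition (Finset.univ : Finset (MCVtx k m H)))
    (hP : ∀ Q ∈ P.parts, Q.card ≤ cap k m)
    (hopt : ∀ P' : Finpartition (Finset.univ : Finset (MCVtx k m H)),
      (∀ Q ∈ P'.parts, Q.card ≤ cap k m) →
        pVal (mcGraph k m H) (mcW k m H) P' ≤ pVal (mcGraph k m H) (mcW k m H) P) :
    ∀ Q ∈ P.parts, (Sum.inr (Sum.inr (Sum.inr (Sum.inr ()))) : MCVtx k m H) ∈ Q →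
      ∀ i : Fin k, (Q.filter (fun v => ∃ ℓ : Fin m, ∃ c : Bool,
        v = (Sum.inl (i, ℓ, c) : MCVtx k m H))).card = m := by
  intro Q hQ hx i
  have hpart : P.part (apexVtx H) = Q := P.part_eq_of_mem hQ hx
  have hf : ∀ y, (Finset.univ.filter (fun v => P.part v = y)).card ≤ cap k m := by
    intro y
    rcases (Finset.univ.filter (fun v => P.part v = y)).eq_empty_or_nonempty with h | ⟨v, hv⟩
    · simp [h]
    · obtain rfl : P.part v = y := (Finset.mem_filter.1 hv).2
      refine (Finset.card_le_card ?_).trans (hP _ (P.part_mem.2 (Finset.mem_univ v)))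
      intro a ha
      rw [← (Finset.mem_filter.1 ha).2]
      exact P.mem_part (Finset.mem_univ a)
  have hmain := card_apexClique_row_of_optimal hk hm P.part (fun y => by convert hf y) (by
    intro g hg
    obtain ⟨P', hP', hv⟩ :=
      exists_finpartition_of_labelling (mcGraph k m H) (mcW k m H) g (cap k m)
        (fun y => by convert hg y)
    rw [← hv, ← pVal_eq_sum_monoEdges]
    exact hopt P' hP') i
  rw [← card_cliqueVtx_image (H := H)] at hmain
  refine Eq.trans (congrArg Finset.card ?_) hmain
  ext v
  simp only [Finset.mem_filter, Finset.mem_image, apexClique, Finset.mem_univ, true_and, hpart]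
  constructor
  · rintro ⟨hv, l, c, rfl⟩
    exact ⟨(i, l, c), ⟨(P.part_eq_of_mem hQ hv).symm, rfl⟩, rfl⟩
  · rintro ⟨⟨j, l, c⟩, ⟨hb, rfl⟩, rfl⟩
    exact ⟨hb ▸ P.mem_part (Finset.mem_univ _), l, c, rfl⟩
end
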